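/- arXiv:1707.08109 — 2 statements merged into one kernel-verified Lean document; each statement's English description precedes it below -/
import Mathlib

section
/- For every universal prefix-free machine U there exists a universal prefix-free machine V such that Ω_U − Ω_V is not a left-c.e. real; equivalently, Ω_U ≠ Ω_V + β for every left-c.e. real β. -/
open scoped Classical

/-- A set of binary strings is prefix-free if no element is a proper prefix of another. -/
def PrefixFreeSet (D : Set (List Bool)) : Prop :=
  ∀ σ ∈ D, ∀ τ ∈ D, σ <+: τ → σ = τ

/-- A prefix-free machine: a partial computable function on binary strings
whose domain is prefix-free. -/
structure PFMachine where
  f : List Bool →. List Bool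
  partrec : Partrec f
  prefixFree : PrefixFreeSet {σ | (f σ).Dom}

/-- The halting probability `Ω_M = Σ_{σ ∈ dom M} 2^{-|σ|}` of a prefix-free machine. -/
noncomputable def omegaOf (M : PFMachine) : ℝ :=
  ∑' σ : {σ : List Bool // (M.f σ).Dom}, (2 : ℝ) ^ (-(σ.1.length : ℤ))

/-- A computable nondecreasing sequence of rationals converging to `x`. -/
def LeftCEApprox (q : ℕ → ℚ) (x : ℝ) : Prop :=
  Computable q ∧ Monotone q ∧
    Filter.Tendsto (fun n => (q n : ℝ)) Filter.atTop (nhds x)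

/-- A real is left-c.e. if some computable nondecreasing rational sequence converges to it. -/
def LeftCE (x : ℝ) : Prop := ∃ q : ℕ → ℚ, LeftCEApprox q x

/-- A real is right-c.e. if its negative is left-c.e. -/
def RightCE (x : ℝ) : Prop := LeftCE (-x)

/-- Martin-Löf randomness of a real, via computable sequences of open rational intervals. -/
def MLRandom (x : ℝ) : Prop :=
  ∀ I : ℕ → ℕ → ℚ × ℚ, Computable₂ I →
    (∀ n : ℕ, MeasureTheory.volume
        (⋃ k : ℕ, Set.Ioo (((I n k).1 : ℝ)) (((I n k).2 : ℝ))) ≤ 2 ^ (-(n : ℤ))) →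
    x ∉ ⋂ n : ℕ, ⋃ k : ℕ, Set.Ioo (((I n k).1 : ℝ)) (((I n k).2 : ℝ))

/-- A universal prefix-free machine: it simulates every prefix-free machine
via a fixed prefix. -/
def UniversalPF (U : PFMachine) : Prop :=
  ∀ M : PFMachine, ∃ ρ : List Bool, ∀ σ : List Bool, U.f (ρ ++ σ) = M.f σ

/-- The `i`-th binary digit of a real (of its expansion not ending in all 1s). -/
noncomputable def rdigit (x : ℝ) (i : ℕ) : Bool := decide (⌊x * 2 ^ (i + 1)⌋ % 2 = 1)

/-- The first `n` binary digits of a real. -/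
noncomputable def bits (x : ℝ) (n : ℕ) : List Bool := (List.range n).map (rdigit x)

/-- Prefix-free Kolmogorov complexity of `σ` with respect to machine `M`,
with value `⊤` if `σ` is not in the range. -/
noncomputable def Kf (M : PFMachine) (σ : List Bool) : ℕ∞ :=
  ⨅ p : {p : List Bool // σ ∈ M.f p}, (p.1.length : ℕ∞)

/-- An optimal prefix-free machine: minimizes `K` up to additive constants. -/
def OptimalPF (V : PFMachine) : Prop :=
  ∀ M : PFMachine, ∃ c : ℕ, ∀ σ : List Bool, Kf V σ ≤ Kf M σ + c

/-- Solovay reducibility for left-c.e. reals. -/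
def SolovayRed (α β : ℝ) : Prop :=
  ∃ c : ℚ, ∃ f : ℚ →. ℚ, Partrec f ∧
    ∀ q : ℚ, (q : ℝ) < β →
      ∃ r ∈ f q, (r : ℝ) < α ∧ α - (r : ℝ) < (c : ℝ) * (β - (q : ℝ))

/-- `X` is computable from `Y` with oracle-use `h`. -/
def ComputableFromWithUse (X Y : ℝ) (h : ℕ → ℕ) : Prop :=
  ∃ Φ : List Bool →. List Bool, Partrec Φ ∧
    ∀ n : ℕ, Φ (bits Y (h n)) = Part.some (bits X n)


/-! ### Numerators and denominators are computable for Mathlib's coding of the rationals -/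

namespace RatCode

open Encodable

/-- `m` codes a reduced fraction: a numerator code paired with a denominator. -/
def IsReduced (m : ℕ) : Prop :=
  0 < m.unpair.2 ∧ ((m.unpair.1 + 1) / 2).Coprime m.unpair.2

theorem natAbs_eq_code (z : ℤ) : z.natAbs = (encode z + 1) / 2 := by
  cases z with
  | ofNat n =>
    change n = (2 * n + 1) / 2
    omega
  | negSucc n =>
    change n + 1 = (2 * n + 1 + 1) / 2
    omega

/-- The code of a rational as a pair of numerator and denominator. -/
def raw (q : ℚ) : ℕ := Nat.pair (encode q.num) q.den

theorem range_raw : Set.range raw = {m | IsReduced m} := by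
  ext m
  constructor
  · rintro ⟨q, rfl⟩
    refine ⟨?_, ?_⟩
    · simpa [raw] using q.den_pos
    · simpa [raw, ← natAbs_eq_code] using q.reduced
  · rintro ⟨h₁, h₂⟩
    have hz := Denumerable.encode_ofNat (α := ℤ) m.unpair.1
    refine ⟨⟨Denumerable.ofNat ℤ m.unpair.1, m.unpair.2, h₁.ne', ?_⟩, ?_⟩
    · rwa [natAbs_eq_code, hz]
    · change Nat.pair (encode (Denumerable.ofNat ℤ m.unpair.1)) m.unpair.2 = m
      rw [hz, Nat.pair_unpair]

theorem encode_eq (q : ℚ) :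
    @encode ℚ Primcodable.toEncodable q =
      ((List.range (raw q)).filter (fun m => decide (IsReduced m))).length := by
  have h : @encode ℚ Primcodable.toEncodable q =
      @List.countP ℕ (fun x => @decide _ (decidableRangeEncode ℚ x)) (List.range (raw q)) := by
    with_unfolding_all rfl
  rw [h, List.countP_eq_length_filter]
  congr 2
  funext m
  refine decide_eq_decide.2 ?_
  change m ∈ Set.range raw ↔ _
  rw [range_raw]
  rfl

theorem primrecPred_isReduced : PrimrecPred IsReduced := by
  have hd : PrimrecRel fun x y : ℕ => x ∣ y :=
    (Primrec.eq.comp (Primrec.nat_mod.comp Primrec.snd Primrec.fst) (Primrec.const 0)).of_eq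
      fun p => (Nat.dvd_iff_mod_eq_zero).symm
  have h1 : Primrec fun m : ℕ => m.unpair.1 := Primrec.fst.comp Primrec.unpair
  have h2 : Primrec fun m : ℕ => m.unpair.2 := Primrec.snd.comp Primrec.unpair
  have ha : Primrec fun m : ℕ => (m.unpair.1 + 1) / 2 :=
    Primrec.nat_div.comp (Primrec.succ.comp h1) (Primrec.const 2)
  have hR : PrimrecRel fun x m : ℕ =>
      ¬(x ∣ (m.unpair.1 + 1) / 2 ∧ x ∣ m.unpair.2 ∧ ¬x = 1) :=
    ((hd.comp Primrec.fst (ha.comp Primrec.snd)).and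
      ((hd.comp Primrec.fst (h2.comp Primrec.snd)).and
        (Primrec.eq.comp Primrec.fst (Primrec.const 1)).not)).not
  refine ((Primrec.nat_lt.comp (Primrec.const 0) h2).and
    (hR.forall_lt.comp Primrec.succ Primrec.id)).of_eq fun m => ?_
  refine and_congr_right fun hpos => ⟨fun h => ?_, fun h x _ hx => hx.2.2 ?_⟩
  · by_contra hc
    refine h (Nat.gcd ((m.unpair.1 + 1) / 2) m.unpair.2) ?_
      ⟨Nat.gcd_dvd_left _ _, Nat.gcd_dvd_right _ _, hc⟩
    exact Nat.lt_succ_of_le ((Nat.gcd_le_right _ hpos).trans (Nat.unpair_right_le m))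
  · exact Nat.eq_one_of_dvd_coprimes h hx.1 hx.2.1

theorem computable_raw : Computable raw := by
  have hc : Primrec fun m : ℕ =>
      ((List.range m).filter (fun m => decide (IsReduced m))).length :=
    Primrec.list_length.comp ((Primrec.listFilter primrecPred_isReduced).comp Primrec.list_range)
  have hp : PrimrecRel fun (q : ℚ) (m : ℕ) => IsReduced m ∧
      ((List.range m).filter (fun m => decide (IsReduced m))).length =
        @encode ℚ Primcodable.toEncodable q :=
    (primrecPred_isReduced.comp Primrec.snd).and
      (Primrec.eq.comp (hc.comp Primrec.snd) (Primrec.encode.comp Primrec.fst))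
  refine (Partrec.rfind hp.decide.to_comp.partrec.to₂).of_eq_tot fun q => ?_
  have hq : IsReduced (raw q) := range_raw.le ⟨q, rfl⟩
  refine Nat.mem_rfind.2 ⟨?_, fun {m} hm => ?_⟩
  · simp [hq, encode_eq]
  · suffices h : ¬(IsReduced m ∧
        ((List.range m).filter (fun m => decide (IsReduced m))).length =
        @encode ℚ Primcodable.toEncodable q) by
      simpa using h
    rintro ⟨h₁, h₂⟩
    obtain ⟨p, rfl⟩ := range_raw.ge h₁
    rw [← encode_eq] at h₂
    rw [@encode_injective ℚ Primcodable.toEncodable _ _ h₂] at hm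
    exact lt_irrefl _ hm

theorem computable_natAbs_num : Computable fun q : ℚ => q.num.natAbs := by
  have h : Primrec fun m : ℕ => (m.unpair.1 + 1) / 2 :=
    Primrec.nat_div.comp (Primrec.succ.comp (Primrec.fst.comp Primrec.unpair)) (Primrec.const 2)
  refine (h.to_comp.comp computable_raw).of_eq fun q => ?_
  simp [raw, natAbs_eq_code]

theorem computable_den : Computable fun q : ℚ => q.den := by
  have h : Primrec fun m : ℕ => m.unpair.2 := Primrec.snd.comp Primrec.unpair
  exact (h.to_comp.comp computable_raw).of_eq fun q => by simp [raw]

end RatCode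

/-! ### Kraft's inequality and grafting one machine onto another -/

theorem PrefixFreeSet.uniquelyDecodable {D : Set (List Bool)} (hD : PrefixFreeSet D)
    (hnil : [] ∉ D) : InformationTheory.UniquelyDecodable D := by
  intro L₁
  induction L₁ with
  | nil =>
    intro L₂ _ h₂ h
    cases L₂ with
    | nil => rfl
    | cons w L =>
      have hw : w = [] := by simp_all
      exact absurd (hw ▸ h₂ w (by simp)) hnil
  | cons v L₁ ih =>
    intro L₂ h₁ h₂ h
    cases L₂ with
    | nil =>
      have hv : v = [] := by simp_all
      exact absurd (hv ▸ h₁ v (by simp)) hnil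
    | cons w L₂ =>
      have hv := h₁ v (by simp)
      have hw := h₂ w (by simp)
      rw [List.flatten_cons, List.flatten_cons] at h
      have hvw : v = w := by
        have hp := List.prefix_append v L₁.flatten
        have hp' : w <+: v ++ L₁.flatten := h ▸ List.prefix_append w L₂.flatten
        rcases le_total v.length w.length with hl | hl
        · exact hD v hv w hw (List.prefix_of_prefix_length_le hp hp' hl)
        · exact (hD w hw v hv (List.prefix_of_prefix_length_le hp' hp hl)).symm
      subst hvw
      rw [ih L₂ (fun x hx => h₁ x (by simp [hx])) (fun x hx => h₂ x (by simp [hx]))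
        (List.append_cancel_left h)]

theorem PrefixFreeSet.summable {D : Set (List Bool)} (hD : PrefixFreeSet D) :
    Summable fun σ : D => (2 : ℝ) ^ (-(σ.1.length : ℤ)) := by
  by_cases hnil : [] ∈ D
  · have : Finite D := (Set.finite_singleton ([] : List Bool)).subset fun σ hσ =>
      (hD [] hnil σ hσ ⟨σ, rfl⟩).symm
    exact Summable.of_finite
  · refine summable_of_sum_le (c := 1) (fun σ => by positivity) fun s => ?_
    have h : InformationTheory.UniquelyDecodable
        ((s.map (Function.Embedding.subtype _) : Finset (List Bool)) : Set (List Bool)) := by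
      intro L₁ L₂ h₁ h₂
      refine hD.uniquelyDecodable hnil L₁ L₂ (fun w hw => ?_) fun w hw => ?_
      · have := h₁ w hw
        simp at this
        exact this.1
      · have := h₂ w hw
        simp at this
        exact this.1
    have hk := InformationTheory.kraft_mcmillan_inequality h
    rw [Finset.sum_map] at hk
    refine le_trans (le_of_eq (Finset.sum_congr rfl fun σ _ => ?_)) hk
    simp [zpow_neg]

namespace PFMachine

/-- The machine that runs `M` on `σ` for inputs `ρ ++ σ` and runs `U` elsewhere. -/
def graft (U M : PFMachine) (ρ : List Bool)
    (hρ : ∀ τ, ρ <+: τ ∨ τ <+: ρ → ¬(U.f τ).Dom) : PFMachine where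
  f τ := bif decide (τ.take ρ.length = ρ) then M.f (τ.drop ρ.length) else U.f τ
  partrec := by
    have h : PrimrecPred fun τ : List Bool => τ.take ρ.length = ρ :=
      Primrec.eq.comp (Primrec.list_take.comp (Primrec.const _) Primrec.id) (Primrec.const _)
    exact Partrec.cond h.decide.to_comp (M.partrec.comp
      (Primrec.list_drop.comp (Primrec.const _) Primrec.id).to_comp) U.partrec
  prefixFree := by
    intro σ hσ τ hτ hστ
    simp only [Set.mem_ofPred_eq, Bool.cond_decide] at hσ hτ
    split_ifs at hσ hτ with h₁ h₂ h₂
    · have hσ' := List.take_append_drop ρ.length σ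
      have hτ' := List.take_append_drop ρ.length τ
      rw [h₁] at hσ'
      rw [h₂] at hτ'
      rw [← hσ', ← hτ'] at hστ ⊢
      rw [M.prefixFree _ hσ _ hτ ((List.prefix_append_right_inj ρ).1 hστ)]
    · exact absurd (List.prefix_iff_eq_take.1
        ((List.prefix_iff_eq_take.2 h₁.symm).trans hστ)).symm h₂
    · have hρτ := List.prefix_iff_eq_take.2 h₂.symm
      exact absurd hσ (hρ σ ((le_total ρ.length σ.length).imp
        (List.prefix_of_prefix_length_le hρτ hστ) (List.prefix_of_prefix_length_le hστ hρτ)))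
    · exact U.prefixFree σ hσ τ hτ hστ

variable {U M : PFMachine} {ρ : List Bool} {hρ : ∀ τ, ρ <+: τ ∨ τ <+: ρ → ¬(U.f τ).Dom}

theorem graft_append (σ : List Bool) : (graft U M ρ hρ).f (ρ ++ σ) = M.f σ := by
  simp [graft]

theorem graft_of_not_prefix_of {τ : List Bool} (hτ : ¬ρ <+: τ) :
    (graft U M ρ hρ).f τ = U.f τ := by
  have h : τ.take ρ.length ≠ ρ := fun h => hτ (List.prefix_iff_eq_take.2 h.symm)
  simp [graft, h]

theorem omegaOf_graft :
    omegaOf (graft U M ρ hρ) = omegaOf U + 2 ^ (-(ρ.length : ℤ)) * omegaOf M := by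
  have hdom : {τ | ((graft U M ρ hρ).f τ).Dom} =
      {τ | (U.f τ).Dom} ∪ (ρ ++ ·) '' {σ | (M.f σ).Dom} := by
    ext τ
    simp only [Set.mem_union, Set.mem_image, Set.mem_ofPred_eq]
    by_cases h : ρ <+: τ
    · obtain ⟨σ, rfl⟩ := h
      simp [graft_append, hρ (ρ ++ σ) (Or.inl (List.prefix_append ρ σ))]
    · rw [graft_of_not_prefix_of h, or_iff_left]
      rintro ⟨σ, _, rfl⟩
      exact h (List.prefix_append ρ σ)
  have hdisj : Disjoint {τ | (U.f τ).Dom} ((ρ ++ ·) '' {σ | (M.f σ).Dom}) := by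
    refine Set.disjoint_left.2 ?_
    rintro _ hU ⟨σ, _, rfl⟩
    exact hρ _ (Or.inl (List.prefix_append ρ σ)) hU
  have hV := (graft U M ρ hρ).prefixFree
  rw [hdom] at hV
  have hsub : PrefixFreeSet ((ρ ++ ·) '' {σ | (M.f σ).Dom}) := fun σ hσ τ hτ =>
    hV σ (Or.inr hσ) τ (Or.inr hτ)
  calc omegaOf (graft U M ρ hρ)
      = ∑' τ : {τ | ((graft U M ρ hρ).f τ).Dom}, (2 : ℝ) ^ (-(τ.1.length : ℤ)) := rfl
    _ = ∑' τ : ({τ | (U.f τ).Dom} ∪ (ρ ++ ·) '' {σ | (M.f σ).Dom} : Set (List Bool)),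
          (2 : ℝ) ^ (-(τ.1.length : ℤ)) := by rw [hdom]
    _ = omegaOf U + ∑' τ : (ρ ++ ·) '' {σ | (M.f σ).Dom}, (2 : ℝ) ^ (-(τ.1.length : ℤ)) :=
        U.prefixFree.summable.tsum_union_disjoint
          (f := fun τ : List Bool => (2 : ℝ) ^ (-(τ.length : ℤ))) hdisj hsub.summable
    _ = _ := by
        rw [tsum_image (fun τ : List Bool => (2 : ℝ) ^ (-(τ.length : ℤ)))
          (List.append_right_injective ρ).injOn, show omegaOf M =
            ∑' σ : {σ | (M.f σ).Dom}, (2 : ℝ) ^ (-(σ.1.length : ℤ)) from rfl, ← tsum_mul_left]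
        congr 1
        refine tsum_congr fun σ => ?_
        rw [← zpow_add₀ two_ne_zero]
        congr 1
        simp
        ring

/-- A universal machine has a string none of whose extensions or prefixes lies in its domain,
and avoids it while simulating itself. -/
theorem exists_hole (hU : UniversalPF U) : ∃ ρ : List Bool,
    (∀ σ, U.f (ρ ++ true :: σ) = U.f σ) ∧
      ∀ τ, (ρ ++ [false] <+: τ ∨ τ <+: ρ ++ [false]) → ¬(U.f τ).Dom := by
  let N : PFMachine :=
    { f := fun τ => bif decide (τ.head? = some true) then U.f τ.tail else Part.none
      partrec := by
        have h : PrimrecPred fun τ : List Bool => τ.head? = some true :=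
          Primrec.eq.comp Primrec.list_head? (Primrec.const _)
        exact Partrec.cond h.decide.to_comp (U.partrec.comp Primrec.list_tail.to_comp)
          Partrec.none
      prefixFree := by
        rintro (_ | ⟨_ | _, σ⟩) hσ (_ | ⟨_ | _, τ⟩) hτ h <;>
          simp_all [List.cons_prefix_cons]
        exact U.prefixFree σ hσ τ hτ h }
  obtain ⟨ρ, h⟩ := hU N
  have htrue (σ) : U.f (ρ ++ true :: σ) = U.f σ := h (true :: σ)
  refine ⟨ρ, htrue, fun τ hτ hdom => ?_⟩
  have hfalse (σ) : ¬(U.f (ρ ++ false :: σ)).Dom := by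
    rw [h (false :: σ)]
    exact id
  rcases hτ with ⟨σ, rfl⟩ | hτ
  · exact hfalse σ (by simpa using hdom)
  · rcases List.prefix_concat_iff.1 hτ with rfl | hτ
    · exact hfalse [] hdom
    · have hmem : (U.f (ρ ++ true :: τ)).Dom := by rwa [htrue]
      have heq := U.prefixFree τ hdom _ hmem (hτ.trans (List.prefix_append ρ _))
      have := hτ.length_le
      have := congrArg List.length heq
      simp at this
      omega

end PFMachine

/-! ### A machine whose halting probability encodes the halting problem -/

namespace HaltingReal

open Nat.Partrec (Code)
open Nat.Partrec.Code

/-- The self-delimiting word attached to `n`, of length `2 * n + 2`. -/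
def word : ℕ → List Bool
  | 0 => [true, true]
  | n + 1 => false :: false :: word n

theorem length_word (n : ℕ) : (word n).length = 2 * n + 2 := by
  induction n with
  | zero => rfl
  | succ n ih => simp [word, ih]; ring

theorem eq_of_word_prefix_word {m n : ℕ} (h : word m <+: word n) : m = n := by
  induction m generalizing n with
  | zero => cases n <;> simp_all [word, List.cons_prefix_cons]
  | succ m ih =>
    cases n with
    | zero => simp [word, List.cons_prefix_cons] at h
    | succ n => rw [ih (by simpa [word, List.cons_prefix_cons] using h)]

theorem word_injective : Function.Injective word := fun _ _ h =>
  eq_of_word_prefix_word (h ▸ List.prefix_rfl)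

theorem primrec_word : Primrec word := by
  have h : Primrec₂ fun (_ : ℕ) (l : List Bool) => false :: false :: l :=
    Primrec.list_cons.comp (Primrec.const _)
      (Primrec.list_cons.comp (Primrec.const _) Primrec.snd)
  refine (Primrec.nat_rec₁ [true, true] h).of_eq fun n => ?_
  induction n with
  | zero => rfl
  | succ n ih => simp only [word, ← ih]

/-- The `n`-th program halts on input `0`. -/
def Halts (n : ℕ) : Prop := (eval (Denumerable.ofNat Code n) 0).Dom

/-- The machine whose domain consists of the words attached to halting programs. -/
def machine : PFMachine where
  f σ := bif decide (word (σ.length / 2 - 1) = σ) then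
      (eval (Denumerable.ofNat Code (σ.length / 2 - 1)) 0).map fun _ => []
    else Part.none
  partrec := by
    have hn : Primrec fun σ : List Bool => σ.length / 2 - 1 :=
      Primrec.nat_sub.comp (Primrec.nat_div.comp Primrec.list_length (Primrec.const 2))
        (Primrec.const 1)
    have h : PrimrecPred fun σ : List Bool => word (σ.length / 2 - 1) = σ :=
      Primrec.eq.comp (primrec_word.comp hn) Primrec.id
    have he : Partrec fun σ : List Bool =>
        eval (Denumerable.ofNat Code (σ.length / 2 - 1)) 0 :=
      eval_part.comp ((Computable.ofNat Code).comp hn.to_comp) (Computable.const 0)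
    exact Partrec.cond h.decide.to_comp (he.map (Computable.const []).to₂) Partrec.none
  prefixFree := by
    intro σ hσ τ hτ h
    simp only [Set.mem_ofPred_eq, Bool.cond_decide] at hσ hτ
    split_ifs at hσ hτ with h₁ h₂
    · rw [← h₁, ← h₂] at h
      rw [← h₁, ← h₂, eq_of_word_prefix_word h]
    all_goals exact absurd ‹_› id

theorem dom_machine : {σ | (machine.f σ).Dom} = word '' {n | Halts n} := by
  ext σ
  simp only [machine, Set.mem_ofPred_eq, Bool.cond_decide, Set.mem_image]
  constructor
  · intro hσ
    split_ifs at hσ with h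
    · exact ⟨_, hσ, h⟩
    · exact absurd hσ id
  · rintro ⟨n, hn, rfl⟩
    have h : (word n).length / 2 - 1 = n := by rw [length_word]; omega
    rw [h, if_pos rfl]
    exact hn

/-- The contribution of the `n`-th program to the halting probability of `machine`. -/
noncomputable def weight (n : ℕ) : ℝ := if Halts n then (1 / 4) ^ (n + 1) else 0

theorem weight_nonneg (n : ℕ) : 0 ≤ weight n := by
  unfold weight
  split_ifs <;> positivity

theorem weight_le (n : ℕ) : weight n ≤ (1 / 4) ^ (n + 1) := by
  unfold weight
  split_ifs
  · exact le_rfl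
  · positivity

theorem hasSum_geometric_tail (n : ℕ) :
    HasSum (fun i : ℕ => (1 / 4 : ℝ) ^ (i + n + 1)) ((1 / 4) ^ n / 3) := by
  have h := (hasSum_geometric_of_lt_one (r := (1 / 4 : ℝ)) (by norm_num) (by norm_num)).mul_left
    ((1 / 4) ^ (n + 1))
  convert! h using 1
  · funext i
    ring
  · ring

theorem summable_weight : Summable weight :=
  Summable.of_nonneg_of_le weight_nonneg weight_le (hasSum_geometric_tail 0).summable

theorem omegaOf_machine : omegaOf machine = ∑' n, weight n := by
  calc omegaOf machine
      = ∑' σ : {σ | (machine.f σ).Dom}, (2 : ℝ) ^ (-(σ.1.length : ℤ)) := rfl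
    _ = ∑' n : {n | Halts n}, (2 : ℝ) ^ (-((word n).length : ℤ)) := by
        rw [dom_machine, tsum_image (fun σ : List Bool => (2 : ℝ) ^ (-(σ.length : ℤ)))
          word_injective.injOn]
    _ = ∑' n, weight n := by
        rw [tsum_subtype {n | Halts n} fun n => (2 : ℝ) ^ (-((word n).length : ℤ))]
        refine tsum_congr fun n => ?_
        simp only [Set.indicator, weight, Set.mem_ofPred_eq]
        congr 1
        rw [length_word, zpow_neg, zpow_natCast, show 2 * n + 2 = 2 * (n + 1) by ring, pow_mul,
          one_div, inv_pow]
        norm_num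

theorem sum_weight_le (n : ℕ) : ∑ i ∈ Finset.range n, weight i ≤ omegaOf machine := by
  rw [omegaOf_machine]
  exact summable_weight.sum_le_tsum _ fun i _ => weight_nonneg i

theorem omegaOf_machine_lt {n : ℕ} (hn : ¬Halts n) :
    omegaOf machine < ∑ i ∈ Finset.range n, weight i + (1 / 4) ^ (n + 1) := by
  have htail : ∑' i, weight (i + (n + 1)) ≤ (1 / 4) ^ (n + 1) / 3 := by
    rw [← (hasSum_geometric_tail (n + 1)).tsum_eq]
    exact Summable.tsum_le_tsum (fun i => weight_le _)
      ((summable_nat_add_iff (n + 1)).2 summable_weight)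
      (hasSum_geometric_tail (n + 1)).summable
  have hpos : (0 : ℝ) < (1 / 4) ^ (n + 1) := by positivity
  rw [omegaOf_machine, ← summable_weight.sum_add_tsum_nat_add (n + 1), Finset.sum_range_succ,
    weight, if_neg hn]
  linarith

/-- The `n`-th program is seen to halt within `s` steps. -/
def haltsBy (s n : ℕ) : Bool := (evaln s (Denumerable.ofNat Code n) 0).isSome

theorem halts_of_haltsBy {s n : ℕ} (h : haltsBy s n) : Halts n := by
  obtain ⟨x, hx⟩ := Option.isSome_iff_exists.1 h
  exact Part.dom_iff_mem.2 ⟨x, evaln_sound hx⟩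

theorem haltsBy_mono {s t n : ℕ} (hst : s ≤ t) (h : haltsBy s n) : haltsBy t n := by
  obtain ⟨x, hx⟩ := Option.isSome_iff_exists.1 h
  exact Option.isSome_iff_exists.2 ⟨x, evaln_mono hst hx⟩

theorem Halts.exists_haltsBy {n : ℕ} (h : Halts n) : ∃ s, haltsBy s n := by
  obtain ⟨x, hx⟩ := Part.dom_iff_mem.1 h
  obtain ⟨s, hs⟩ := evaln_complete.1 hx
  exact ⟨s, Option.isSome_iff_exists.2 ⟨x, hs⟩⟩

/-- The stage-`s` approximation of `4 ^ n * ∑ i < n, weight i`. -/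
def approx (s : ℕ) : ℕ → ℕ
  | 0 => 0
  | n + 1 => 4 * approx s n + (haltsBy s n).toNat

theorem primrec_approx : Primrec₂ approx := by
  have hb : Primrec₂ haltsBy :=
    Primrec.option_isSome.comp (primrec_evaln.comp
      ((Primrec.fst.pair ((Primrec.ofNat Code).comp Primrec.snd)).pair (Primrec.const 0)))
  have hs : Primrec₂ fun (s : ℕ) (p : ℕ × ℕ) => 4 * p.2 + (haltsBy s p.1).toNat :=
    Primrec.nat_add.comp
      (Primrec.nat_mul.comp (Primrec.const 4) (Primrec.snd.comp Primrec.snd))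
      ((Primrec.dom_bool Bool.toNat).comp
        (hb.comp Primrec.fst (Primrec.fst.comp Primrec.snd)))
  refine (Primrec.nat_rec (Primrec.const 0) hs).of_eq fun s n => ?_
  induction n with
  | zero => rfl
  | succ n ih =>
    simp only [approx]
    rw [← ih]

theorem approx_le (s n : ℕ) :
    (approx s n : ℝ) ≤ 4 ^ n * ∑ i ∈ Finset.range n, weight i := by
  induction n with
  | zero => simp [approx]
  | succ n ih =>
    have h : ((haltsBy s n).toNat : ℝ) ≤ 4 ^ (n + 1) * weight n := by
      by_cases hb : haltsBy s n
      · simp [hb, weight, halts_of_haltsBy hb]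
      · have := weight_nonneg n
        simp only [hb, Bool.toNat_false, Nat.cast_zero]
        positivity
    rw [Finset.sum_range_succ, approx]
    push_cast
    rw [mul_add, pow_succ']
    rw [pow_succ'] at h
    linarith

theorem exists_approx_eq (n : ℕ) :
    ∃ s, ∀ t ≥ s, (approx t n : ℝ) = 4 ^ n * ∑ i ∈ Finset.range n, weight i := by
  induction n with
  | zero => exact ⟨0, fun t _ => by simp [approx]⟩
  | succ n ih =>
    obtain ⟨s, hs⟩ := ih
    have h : ∃ s', ∀ t ≥ s', ((haltsBy t n).toNat : ℝ) = 4 ^ (n + 1) * weight n := by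
      by_cases hn : Halts n
      · obtain ⟨s', hs'⟩ := hn.exists_haltsBy
        exact ⟨s', fun t ht => by simp [haltsBy_mono ht hs', weight, hn]⟩
      · refine ⟨0, fun t _ => ?_⟩
        have hb : haltsBy t n = false := by
          by_contra hb
          exact hn (halts_of_haltsBy (by simpa using hb))
        simp [hb, weight, hn]
    obtain ⟨s', hs'⟩ := h
    refine ⟨max s s', fun t ht => ?_⟩
    have h₁ := hs t (le_trans (le_max_left _ _) ht)
    have h₂ := hs' t (le_trans (le_max_right _ _) ht)
    rw [Finset.sum_range_succ, approx]
    push_cast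
    rw [h₁, h₂]
    ring

theorem not_leftCE_neg_mul (k : ℕ) : ¬LeftCE (-(2 ^ (-(k : ℤ)) * omegaOf machine)) := by
  rintro ⟨q, hq, hmono, hlim⟩
  have hle (t : ℕ) : (q t : ℝ) ≤ -(2 ^ (-(k : ℤ)) * omegaOf machine) :=
    Monotone.ge_of_tendsto (fun a b hab => Rat.cast_le.2 (hmono hab)) hlim t
  have hΩ : 0 ≤ omegaOf machine := by simpa using sum_weight_le 0
  have hq0 (t : ℕ) : q t ≤ 0 := by
    have h : (0 : ℝ) ≤ 2 ^ (-(k : ℤ)) * omegaOf machine := by positivity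
    exact_mod_cast (hle t).trans (neg_nonpos.2 h)
  have key (n s t : ℕ) :
      (q t).num.natAbs * (2 ^ k * 4 ^ (n + 1)) < (4 * approx s n + 1) * (q t).den ↔
        -(q t : ℝ) * 2 ^ k < approx s n / 4 ^ n + (1 / 4) ^ (n + 1) := by
    have hden : (0 : ℝ) < (q t).den := by exact_mod_cast (q t).den_pos
    have hnum : ((q t).num.natAbs : ℝ) = -(q t : ℝ) * (q t).den := by
      have h₁ : ((q t).num.natAbs : ℤ) = -(q t).num := by
        have := Rat.num_nonpos.2 (hq0 t)
        omega
      have h₂ : (q t : ℝ) * (q t).den = (q t).num := by exact_mod_cast Rat.mul_den_eq_num (q t)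
      rw [neg_mul, h₂]
      rw [← Int.cast_natCast (q t).num.natAbs, h₁, Int.cast_neg]
    rw [← Nat.cast_lt (α := ℝ)]
    push_cast
    rw [hnum]
    have h₁ : -(q t : ℝ) * (q t).den * (2 ^ k * 4 ^ (n + 1)) =
        (-(q t : ℝ) * 2 ^ k) * (4 ^ (n + 1) * (q t).den) := by ring
    have h₂ : (4 * approx s n + 1 : ℝ) * (q t).den =
        (approx s n / 4 ^ n + (1 / 4) ^ (n + 1)) * (4 ^ (n + 1) * (q t).den) := by
      rw [one_div, inv_pow]
      field_simp
      ring
    rw [h₁, h₂]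
    exact mul_lt_mul_iff_left₀ (by positivity)
  have hiff (n : ℕ) : (∃ m : ℕ, (q m.unpair.2).num.natAbs * (2 ^ k * 4 ^ (n + 1)) <
      (4 * approx m.unpair.1 n + 1) * (q m.unpair.2).den) ↔ ¬Halts n := by
    have h2 : (0 : ℝ) < 2 ^ k := by positivity
    have hscale : 2 ^ (-(k : ℤ)) * omegaOf machine * 2 ^ k = omegaOf machine := by
      rw [zpow_neg, zpow_natCast]
      field_simp
    simp only [key]
    constructor
    · rintro ⟨m, hm⟩ hn
      have h₁ := sum_weight_le (n + 1)
      rw [Finset.sum_range_succ, weight, if_pos hn] at h₁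
      have h₂ : (approx m.unpair.1 n : ℝ) / 4 ^ n ≤ ∑ i ∈ Finset.range n, weight i := by
        rw [div_le_iff₀' (by positivity)]
        exact approx_le _ _
      have h₃ := mul_le_mul_of_nonneg_right (le_neg.1 (hle m.unpair.2)) h2.le
      linarith
    · intro hn
      obtain ⟨s, hs⟩ := exists_approx_eq n
      have h₁ : (approx s n : ℝ) / 4 ^ n = ∑ i ∈ Finset.range n, weight i := by
        rw [hs s le_rfl]
        field_simp
      have hlim' : Filter.Tendsto (fun t => -(q t : ℝ) * 2 ^ k) Filter.atTop
          (nhds (omegaOf machine)) := by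
        have := hlim.neg.mul_const (2 ^ k)
        rwa [neg_neg, hscale] at this
      obtain ⟨t, ht⟩ := (hlim'.eventually_lt_const (omegaOf_machine_lt hn)).exists
      exact ⟨Nat.pair s t, by simpa [h₁] using ht⟩
  have hpow : Primrec₂ fun a b : ℕ => a ^ b := Primrec₂.unpaired'.1 Nat.Primrec.pow
  have hcomp : Computable fun p : Code × ℕ =>
      decide ((q p.2.unpair.2).num.natAbs * (2 ^ k * 4 ^ (Encodable.encode p.1 + 1)) <
        (4 * approx p.2.unpair.1 (Encodable.encode p.1) + 1) * (q p.2.unpair.2).den) := by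
    have hn : Primrec fun p : Code × ℕ => Encodable.encode p.1 := Primrec.encode.comp Primrec.fst
    have hu : Primrec fun p : Code × ℕ => p.2.unpair := Primrec.unpair.comp Primrec.snd
    have hqt : Computable fun p : Code × ℕ => q p.2.unpair.2 :=
      hq.comp (Primrec.snd.comp hu).to_comp
    have h₁ : Primrec fun p : Code × ℕ => 2 ^ k * 4 ^ (Encodable.encode p.1 + 1) :=
      Primrec.nat_mul.comp (Primrec.const _) (hpow.comp (Primrec.const 4) (Primrec.succ.comp hn))
    have h₂ : Primrec fun p : Code × ℕ =>
        4 * approx p.2.unpair.1 (Encodable.encode p.1) + 1 :=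
      Primrec.succ.comp (Primrec.nat_mul.comp (Primrec.const 4)
        (primrec_approx.comp (Primrec.fst.comp hu) hn))
    exact Primrec.nat_lt.decide.to_comp.comp
      (Primrec.nat_mul.to_comp.comp (RatCode.computable_natAbs_num.comp hqt) h₁.to_comp)
      (Primrec.nat_mul.to_comp.comp h₂.to_comp (RatCode.computable_den.comp hqt))
  refine ComputablePred.halting_problem_not_re 0
    ((Partrec.rfind hcomp.partrec.to₂).dom_re.of_eq fun c => ?_)
  have h := hiff (Encodable.encode c)
  rw [Halts, Denumerable.ofNat_encode] at h
  rw [← h]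
  exact Nat.rfind_dom'.trans (by simp)

end HaltingReal

/-- for every universal prefix-free machine U there is a universal
prefix-free machine V such that Ω_U − Ω_V is not left-c.e.; equivalently
Ω_U ≠ Ω_V + β for every left-c.e. real β. -/
theorem stmt_17 (U : PFMachine) (hU : UniversalPF U) :
    ∃ V : PFMachine, UniversalPF V ∧ ¬ LeftCE (omegaOf U - omegaOf V) ∧
      ∀ β : ℝ, LeftCE β → omegaOf U ≠ omegaOf V + β := by
  obtain ⟨ρ, hself, hhole⟩ := PFMachine.exists_hole hU
  have hnot : ¬LeftCE (omegaOf U -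
      omegaOf (PFMachine.graft U HaltingReal.machine (ρ ++ [false]) hhole)) := by
    rw [PFMachine.omegaOf_graft, sub_add_cancel_left]
    exact HaltingReal.not_leftCE_neg_mul _
  refine ⟨_, fun M => ?_, hnot, fun β hβ h => hnot ?_⟩
  · obtain ⟨π, hπ⟩ := hU M
    refine ⟨ρ ++ true :: π, fun σ => ?_⟩
    rw [PFMachine.graft_of_not_prefix_of, List.append_assoc, List.cons_append, hself, hπ]
    simp [List.cons_prefix_cons]
  · rwa [h, add_sub_cancel_left]
end

section
/- A left-c.e. real β in (0,1) is Martin-Löf random if and only if for every left-c.e. real α in (0,1) there is a constant c such that K(α↾n | β↾n) ≤ c for all n. -/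
open scoped Classical

/-- A conditional prefix-free machine: a partial computable function of a program and
a condition string, prefix-free in the program for each fixed condition. -/
structure CondPFMachine where
  f : List Bool → List Bool →. List Bool
  partrec : Partrec₂ f
  prefixFree : ∀ τ : List Bool, PrefixFreeSet {p | (f p τ).Dom}

/-- Conditional prefix-free Kolmogorov complexity. -/
noncomputable def Kcond (M : CondPFMachine) (σ τ : List Bool) : ℕ∞ :=
  ⨅ p : {p : List Bool // σ ∈ M.f p τ}, (p.1.length : ℕ∞)

/-- An optimal conditional prefix-free machine. -/
def OptimalCond (M : CondPFMachine) : Prop :=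
  ∀ N : CondPFMachine, ∃ c : ℕ, ∀ σ τ : List Bool, Kcond M σ τ ≤ Kcond N σ τ + c

section Auxiliary

open Encodable

theorem computable_find {α : Type*} [Primcodable α] {p : α → ℕ → Bool} (hp : Computable₂ p)
    (h : ∀ a, ∃ n, p a n = true) : Computable fun a => Nat.find (h a) := by
  refine Partrec.of_eq_tot (Partrec.rfind (Computable₂.partrec₂ hp)) fun a => ?_
  refine Nat.mem_rfind.2 ⟨?_, fun {m} hm => ?_⟩
  · exact Part.mem_some_iff.2 (Nat.find_spec (h a)).symm
  · exact Part.mem_some_iff.2 (by simpa using Nat.find_min (h a) hm)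

/-- The code of a rational number in the (non-surjective) encoding by numerator and denominator. -/
def ratCode (q : ℚ) : ℕ := Nat.pair (encode q.num) q.den

theorem ratCode_eq : ratCode = @encode ℚ Rat.instEncodable := rfl

theorem encode_rat_eq (q : ℚ) :
    @encode ℚ Primcodable.toEncodable q =
      ((List.range (ratCode q)).filter (fun y => y ∈ Set.range ratCode)).length := by
  rw [← List.countP_eq_length_filter]
  have : @encode ℚ Primcodable.toEncodable q = (List.range (ratCode q)).countP
    (fun y => @decide (y ∈ Set.range (@encode ℚ Rat.instEncodable)) (decidableRangeEncode _ _)) := rfl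
  rw [this]
  simp only [ratCode_eq]
  congr! 1
  ext x
  exact decide_eq_decide.2 Iff.rfl

theorem encode_int_ofNat (n : ℕ) : encode (n : ℤ) = 2 * n := rfl

theorem encode_int_negSucc (n : ℕ) : encode (Int.negSucc n) = 2 * n + 1 := rfl

theorem mem_range_ratCode (y : ℕ) : y ∈ Set.range ratCode ↔
    0 < y.unpair.2 ∧ ¬ ∃ x < y.unpair.2 + 1, 2 ≤ x ∧ ((y.unpair.1 + 1) / 2) % x = 0 ∧
      y.unpair.2 % x = 0 := by
  have key : ∀ a d : ℕ, 0 < d → ((¬ ∃ x < d + 1, 2 ≤ x ∧ a % x = 0 ∧ d % x = 0) ↔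
      a.Coprime d) := by
    intro a d hd
    constructor
    · intro h
      by_contra hc
      refine h ⟨a.gcd d, Nat.lt_succ_of_le (Nat.le_of_dvd hd (Nat.gcd_dvd_right a d)), ?_,
        Nat.mod_eq_zero_of_dvd (Nat.gcd_dvd_left a d),
        Nat.mod_eq_zero_of_dvd (Nat.gcd_dvd_right a d)⟩
      have := Nat.gcd_pos_of_pos_right a hd
      have h' : a.gcd d ≠ 1 := hc
      omega
    · rintro h ⟨x, -, hx, h1, h2⟩
      have := Nat.dvd_gcd (Nat.dvd_of_mod_eq_zero h1) (Nat.dvd_of_mod_eq_zero h2)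
      rw [h.gcd_eq_one] at this
      have := Nat.le_of_dvd one_pos this
      omega
  have natAbs_code : ∀ z : ℤ, (encode z + 1) / 2 = z.natAbs := by
    rintro (n | n)
    · have := encode_int_ofNat n
      simp only [Int.ofNat_eq_natCast, this, Int.natAbs_natCast]
      omega
    · rw [encode_int_negSucc]
      simp
      omega
  constructor
  · rintro ⟨q, rfl⟩
    simp only [ratCode, Nat.unpair_pair]
    exact ⟨q.pos, (key _ _ q.pos).2 (by rw [natAbs_code]; exact q.reduced)⟩
  · rintro ⟨h1, h2⟩
    rw [key _ _ h1] at h2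
    obtain ⟨z, hz⟩ : ∃ z : ℤ, encode z = y.unpair.1 :=
      ⟨Denumerable.ofNat ℤ _, Denumerable.encode_ofNat _⟩
    rw [← hz, natAbs_code] at h2
    refine ⟨⟨z, y.unpair.2, h1.ne', h2⟩, ?_⟩
    simp [ratCode, hz]

theorem primrecPred_mem_range_ratCode : PrimrecPred (fun y => y ∈ Set.range ratCode) := by
  have hd : Primrec fun y : ℕ => y.unpair.2 := Primrec.snd.comp Primrec.unpair
  have ha : Primrec fun y : ℕ => (y.unpair.1 + 1) / 2 :=
    Primrec.nat_div.comp (Primrec.succ.comp (Primrec.fst.comp Primrec.unpair)) (Primrec.const 2)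
  have hR : PrimrecRel (fun x y : ℕ => 2 ≤ x ∧ ((y.unpair.1 + 1) / 2) % x = 0 ∧
      y.unpair.2 % x = 0) := by
    refine PrimrecPred.primrecRel (p := fun p : ℕ × ℕ => 2 ≤ p.1 ∧
      ((p.2.unpair.1 + 1) / 2) % p.1 = 0 ∧ p.2.unpair.2 % p.1 = 0) ?_
    refine PrimrecPred.and (Primrec.nat_le.comp (Primrec.const 2) Primrec.fst)
      (PrimrecPred.and ?_ ?_)
    · exact Primrec.eq.comp (Primrec.nat_mod.comp (ha.comp Primrec.snd) Primrec.fst)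
        (Primrec.const 0)
    · exact Primrec.eq.comp (Primrec.nat_mod.comp (hd.comp Primrec.snd) Primrec.fst)
        (Primrec.const 0)
  refine PrimrecPred.of_eq (PrimrecPred.and (Primrec.nat_lt.comp (Primrec.const 0) hd)
    (PrimrecPred.not (hR.exists_lt.comp (Primrec.succ.comp hd) Primrec.id)))
    (fun y => (mem_range_ratCode y).symm)

theorem computable_ratCode : Computable ratCode := by
  have hc : Primrec fun y : ℕ =>
      ((List.range y).filter (fun y => y ∈ Set.range ratCode)).length :=
    Primrec.list_length.comp
      ((Primrec.listFilter primrecPred_mem_range_ratCode).comp Primrec.list_range)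
  have hp : PrimrecRel fun (q : ℚ) (y : ℕ) => y ∈ Set.range ratCode ∧
      ((List.range y).filter (fun y => y ∈ Set.range ratCode)).length =
        @encode ℚ Primcodable.toEncodable q := by
    refine PrimrecPred.primrecRel (p := fun p : ℚ × ℕ => p.2 ∈ Set.range ratCode ∧
      ((List.range p.2).filter (fun y => y ∈ Set.range ratCode)).length =
        @encode ℚ Primcodable.toEncodable p.1) ?_
    exact (primrecPred_mem_range_ratCode.comp Primrec.snd).and
      (Primrec.eq.comp (hc.comp Primrec.snd) (Primrec.encode.comp Primrec.fst))
  have hp' := (PrimrecRel.decide hp).to_comp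
  have h : ∀ q : ℚ, ∃ y, decide (y ∈ Set.range ratCode ∧
      ((List.range y).filter (fun y => y ∈ Set.range ratCode)).length =
        @encode ℚ Primcodable.toEncodable q) = true := fun q =>
    ⟨ratCode q, decide_eq_true ⟨⟨q, rfl⟩, (encode_rat_eq q).symm⟩⟩
  refine (computable_find hp' h).of_eq fun q => ?_
  obtain ⟨⟨q', h1⟩, h2⟩ := of_decide_eq_true (Nat.find_spec (h q))
  rw [← h1, ← encode_rat_eq] at h2
  rw [← h1, @encode_injective ℚ Primcodable.toEncodable _ _ h2]

/-- The numerator of the positive part. -/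
def ratPos (q : ℚ) : ℕ := q.num.toNat

/-- The numerator of the negative part. -/
def ratNeg (q : ℚ) : ℕ := (-q.num).toNat

theorem computable_den : Computable Rat.den :=
  ((Primrec.snd.comp Primrec.unpair).to_comp.comp computable_ratCode).of_eq fun q => by
    simp [ratCode]

theorem computable_encode_num : Computable (fun q : ℚ => encode q.num) :=
  ((Primrec.fst.comp Primrec.unpair).to_comp.comp computable_ratCode).of_eq fun q => by
    simp [ratCode]

theorem computable_ratPos : Computable ratPos := by
  have h : Primrec fun a : ℕ => if a % 2 = 0 then a / 2 else 0 :=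
    Primrec.ite (Primrec.eq.comp (Primrec.nat_mod.comp Primrec.id (Primrec.const 2))
      (Primrec.const 0)) (Primrec.nat_div.comp Primrec.id (Primrec.const 2)) (Primrec.const 0)
  refine (h.to_comp.comp computable_encode_num).of_eq fun q => ?_
  rw [ratPos]
  rcases q.num with n | n
  · simp [encode_int_ofNat]
  · rw [encode_int_negSucc, if_neg (by omega)]
    rfl

theorem computable_ratNeg : Computable ratNeg := by
  have h : Primrec fun a : ℕ => if a % 2 = 1 then (a + 1) / 2 else 0 :=
    Primrec.ite (Primrec.eq.comp (Primrec.nat_mod.comp Primrec.id (Primrec.const 2))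
      (Primrec.const 1)) (Primrec.nat_div.comp Primrec.succ (Primrec.const 2)) (Primrec.const 0)
  refine (h.to_comp.comp computable_encode_num).of_eq fun q => ?_
  rw [ratNeg]
  rcases q.num with n | n
  · simp [encode_int_ofNat]
  · rw [encode_int_negSucc, if_pos (by omega)]
    change _ = n + 1
    omega

theorem rat_eq_frac (q : ℚ) : q = ((ratPos q : ℚ) - ratNeg q) / q.den := by
  have : ((ratPos q : ℤ) - ratNeg q) = q.num := by
    unfold ratPos ratNeg; omega
  have h2 : ((ratPos q : ℚ) - ratNeg q) = q.num := by exact_mod_cast this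
  rw [h2, Rat.num_div_den]

theorem computable_frac {α : Type*} [Primcodable α] {f g h : α → ℕ} (hf : Computable f)
    (hg : Computable g) (hh : Computable h) (h0 : ∀ a, 0 < h a) :
    Computable fun a => ((f a : ℚ) - g a) / h a := by
  have hadd := Primrec.nat_add.to_comp
  have hmul := Primrec.nat_mul.to_comp
  have hq : Computable fun x : α × ℕ => Denumerable.ofNat ℚ x.2 :=
    (Computable.ofNat ℚ).comp Computable.snd
  have hp : Computable₂ fun (a : α) (n : ℕ) =>
      decide (ratPos (Denumerable.ofNat ℚ n) * h a + g a * (Denumerable.ofNat ℚ n).den =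
        f a * (Denumerable.ofNat ℚ n).den + ratNeg (Denumerable.ofNat ℚ n) * h a) := by
    have heq : Computable₂ fun x y : ℕ => decide (x = y) :=
      (PrimrecRel.decide Primrec.eq).to_comp
    exact heq.comp
      (hadd.comp (hmul.comp (computable_ratPos.comp hq) (hh.comp Computable.fst))
        (hmul.comp (hg.comp Computable.fst) (computable_den.comp hq)))
      (hadd.comp (hmul.comp (hf.comp Computable.fst) (computable_den.comp hq))
        (hmul.comp (computable_ratNeg.comp hq) (hh.comp Computable.fst)))
  have key : ∀ (a : α) (q : ℚ), ratPos q * h a + g a * q.den = f a * q.den + ratNeg q * h a ↔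
      q = ((f a : ℚ) - g a) / h a := by
    intro a q
    have h1 : (0 : ℚ) < h a := by exact_mod_cast h0 a
    have h2 : (0 : ℚ) < q.den := by exact_mod_cast q.pos
    conv_rhs => rw [rat_eq_frac q]
    rw [div_eq_div_iff h2.ne' h1.ne', ← @Nat.cast_inj ℚ]
    push_cast
    constructor <;> intro h <;> linarith
  have hex : ∀ a, ∃ n, decide (ratPos (Denumerable.ofNat ℚ n) * h a +
      g a * (Denumerable.ofNat ℚ n).den = f a * (Denumerable.ofNat ℚ n).den +
        ratNeg (Denumerable.ofNat ℚ n) * h a) = true := fun a =>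
    ⟨@encode ℚ Primcodable.toEncodable (((f a : ℚ) - g a) / h a), by
      rw [decide_eq_true_iff, key]; exact Denumerable.ofNat_encode _⟩
  exact ((Computable.ofNat ℚ).comp (computable_find hp hex)).of_eq fun a =>
    (key a _).1 (of_decide_eq_true (Nat.find_spec (hex a)))

section
variable {α : Type*} [Primcodable α]

theorem Computable.nat_add {f g : α → ℕ} (hf : Computable f) (hg : Computable g) :
    Computable fun a => f a + g a := Primrec.nat_add.to_comp.comp hf hg

theorem Computable.nat_sub {f g : α → ℕ} (hf : Computable f) (hg : Computable g) :
    Computable fun a => f a - g a := Primrec.nat_sub.to_comp.comp hf hg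

theorem Computable.nat_mul {f g : α → ℕ} (hf : Computable f) (hg : Computable g) :
    Computable fun a => f a * g a := Primrec.nat_mul.to_comp.comp hf hg

theorem Computable.nat_div {f g : α → ℕ} (hf : Computable f) (hg : Computable g) :
    Computable fun a => f a / g a := Primrec.nat_div.to_comp.comp hf hg

theorem primrec_nat_pow : Primrec₂ fun a b : ℕ => a ^ b :=
  Primrec₂.unpaired'.1 Nat.Primrec.pow

theorem Computable.nat_pow {f g : α → ℕ} (hf : Computable f) (hg : Computable g) :
    Computable fun a => f a ^ g a := primrec_nat_pow.to_comp.comp hf hg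

theorem Computable.nat_lt {f g : α → ℕ} (hf : Computable f) (hg : Computable g) :
    Computable fun a => decide (f a < g a) :=
  (PrimrecRel.decide Primrec.nat_lt).to_comp.comp hf hg

theorem Computable.nat_eq {f g : α → ℕ} (hf : Computable f) (hg : Computable g) :
    Computable fun a => decide (f a = g a) :=
  (PrimrecRel.decide Primrec.eq).to_comp.comp hf hg

theorem Computable.bool_and {f g : α → Bool} (hf : Computable f) (hg : Computable g) :
    Computable fun a => f a && g a := Primrec.and.to_comp.comp hf hg

theorem Computable.bool_not {f : α → Bool} (hf : Computable f) :
    Computable fun a => !f a := Primrec.not.to_comp.comp hf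

theorem Computable.rat_natCast {f : α → ℕ} (hf : Computable f) :
    Computable fun a => (f a : ℚ) :=
  (computable_frac hf (.const 0) (.const 1) (fun _ => one_pos)).of_eq fun a => by simp

theorem Computable.rat_inv_two_pow {f : α → ℕ} (hf : Computable f) :
    Computable fun a => ((1 : ℚ) / 2 ^ f a) :=
  (computable_frac (.const 1) (.const 0) ((Computable.const 2).nat_pow hf)
    (fun _ => by positivity)).of_eq fun a => by simp

theorem Computable.rat_add {f g : α → ℚ} (hf : Computable f) (hg : Computable g) :
    Computable fun a => f a + g a := by
  have P := computable_ratPos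
  have N := computable_ratNeg
  have D := computable_den
  refine (computable_frac
    (((P.comp hf).nat_mul (D.comp hg)).nat_add ((P.comp hg).nat_mul (D.comp hf)))
    (((N.comp hf).nat_mul (D.comp hg)).nat_add ((N.comp hg).nat_mul (D.comp hf)))
    ((D.comp hf).nat_mul (D.comp hg)) (fun _ => by positivity)).of_eq fun a => ?_
  have h1 : ((f a).den : ℚ) ≠ 0 := by positivity
  have h2 : ((g a).den : ℚ) ≠ 0 := by positivity
  conv_rhs => rw [rat_eq_frac (f a), rat_eq_frac (g a)]
  push_cast
  field_simp
  ring

theorem Computable.rat_neg {f : α → ℚ} (hf : Computable f) : Computable fun a => - f a := by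
  refine (computable_frac (computable_ratNeg.comp hf) (computable_ratPos.comp hf)
    (computable_den.comp hf) (fun _ => by positivity)).of_eq fun a => ?_
  conv_rhs => rw [rat_eq_frac (f a)]
  ring

theorem Computable.rat_sub {f g : α → ℚ} (hf : Computable f) (hg : Computable g) :
    Computable fun a => f a - g a :=
  (hf.rat_add hg.rat_neg).of_eq fun _ => by ring

theorem Computable.rat_mul {f g : α → ℚ} (hf : Computable f) (hg : Computable g) :
    Computable fun a => f a * g a := by
  have P := computable_ratPos
  have N := computable_ratNeg
  have D := computable_den
  refine (computable_frac
    (((P.comp hf).nat_mul (P.comp hg)).nat_add ((N.comp hf).nat_mul (N.comp hg)))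
    (((P.comp hf).nat_mul (N.comp hg)).nat_add ((N.comp hf).nat_mul (P.comp hg)))
    ((D.comp hf).nat_mul (D.comp hg)) (fun _ => by positivity)).of_eq fun a => ?_
  have h1 : ((f a).den : ℚ) ≠ 0 := by positivity
  have h2 : ((g a).den : ℚ) ≠ 0 := by positivity
  conv_rhs => rw [rat_eq_frac (f a), rat_eq_frac (g a)]
  push_cast
  field_simp
  ring

theorem Computable.rat_lt {f g : α → ℚ} (hf : Computable f) (hg : Computable g) :
    Computable fun a => decide (f a < g a) := by
  have P := computable_ratPos
  have N := computable_ratNeg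
  have D := computable_den
  refine (Computable.nat_lt
    (((P.comp hf).nat_mul (D.comp hg)).nat_add ((N.comp hg).nat_mul (D.comp hf)))
    (((P.comp hg).nat_mul (D.comp hf)).nat_add ((N.comp hf).nat_mul (D.comp hg)))).of_eq
    fun a => decide_eq_decide.2 ?_
  have h1 : (0 : ℚ) < (f a).den := by positivity
  have h2 : (0 : ℚ) < (g a).den := by positivity
  conv_rhs => rw [rat_eq_frac (f a), rat_eq_frac (g a)]
  rw [div_lt_div_iff₀ h1 h2, ← @Nat.cast_lt ℚ]
  push_cast
  constructor <;> intro h <;> linarith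

theorem Computable.rat_le {f g : α → ℚ} (hf : Computable f) (hg : Computable g) :
    Computable fun a => decide (f a ≤ g a) :=
  (hg.rat_lt hf).bool_not.of_eq fun a => by
    rw [← decide_not]; exact decide_eq_decide.2 not_lt

/-- Bounded existential quantification preserves computability. -/
theorem Computable.exists_lt {p : α → ℕ → Prop} (hp : Computable₂ fun a n => decide (p a n))
    {f : α → ℕ} (hf : Computable f) : Computable fun a => decide (∃ k < f a, p a k) := by
  have h : Computable fun a => Nat.rec (motive := fun _ => Bool) false
      (fun k b => b || decide (p a k)) (f a) :=
    Computable.nat_rec (g := fun _ => false) (h := fun a (x : ℕ × Bool) => x.2 || decide (p a x.1))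
      hf (.const false)
      (Primrec.or.to_comp.comp (Computable.snd.comp Computable.snd)
        (hp.comp Computable.fst (Computable.fst.comp Computable.snd)))
  refine h.of_eq fun a => ?_
  generalize f a = n
  induction n with
  | zero => simp
  | succ n ih =>
    simp only [ih, Nat.lt_succ_iff_lt_or_eq]
    rw [Bool.eq_iff_iff]
    simp only [Bool.or_eq_true, decide_eq_true_iff]
    constructor
    · rintro (⟨k, h1, h2⟩ | h)
      exacts [⟨k, .inl h1, h2⟩, ⟨n, .inr rfl, h⟩]
    · rintro ⟨k, h1 | rfl, h2⟩
      exacts [.inl ⟨k, h1, h2⟩, .inr h2]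

end

/-- The natural number written in binary by a list of digits. -/
def listVal (l : List Bool) : ℕ := l.foldl (fun a b => 2 * a + b.toNat) 0

/-- The `n` lowest binary digits of `v`, most significant digit first. -/
def natBits (v n : ℕ) : List Bool :=
  (List.range n).map fun i => decide (v / 2 ^ (n - 1 - i) % 2 = 1)

theorem primrec_listVal : Primrec listVal :=
  Primrec.list_foldl Primrec.id (Primrec.const 0)
    (h := fun (_ : List Bool) (x : ℕ × Bool) => 2 * x.1 + x.2.toNat)
    (Primrec.nat_add.comp
      (Primrec.nat_mul.comp (Primrec.const 2) (Primrec.fst.comp Primrec.snd))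
      ((Primrec.dom_bool Bool.toNat).comp (Primrec.snd.comp Primrec.snd)))

theorem primrec_natBits : Primrec₂ natBits := by
  refine Primrec.list_map (Primrec.list_range.comp Primrec.snd)
    (g := fun (x : ℕ × ℕ) i => decide (x.1 / 2 ^ (x.2 - 1 - i) % 2 = 1)) ?_
  refine PrimrecRel.decide (PrimrecPred.primrecRel
    (p := fun y : (ℕ × ℕ) × ℕ => y.1.1 / 2 ^ (y.1.2 - 1 - y.2) % 2 = 1) ?_)
  refine Primrec.eq.comp (Primrec.nat_mod.comp (Primrec.nat_div.comp
    (Primrec.fst.comp Primrec.fst) (primrec_nat_pow.comp (Primrec.const 2)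
      (Primrec.nat_sub.comp (Primrec.nat_sub.comp (Primrec.snd.comp Primrec.fst)
        (Primrec.const 1)) Primrec.snd))) (Primrec.const 2)) (Primrec.const 1)

theorem length_bits (x : ℝ) (n : ℕ) : (bits x n).length = n := by simp [bits]

theorem rdigit_eq {x : ℝ} (hx : 0 ≤ x) (i : ℕ) :
    rdigit x i = decide (⌊x * 2 ^ (i + 1)⌋₊ % 2 = 1) := by
  have h : 0 ≤ x * 2 ^ (i + 1) := by positivity
  rw [rdigit, ← Int.natCast_floor_eq_floor h]
  refine decide_eq_decide.2 ?_
  omega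

theorem floor_mul_two_pow_div {x : ℝ} {i n : ℕ} (hi : i ≤ n) :
    ⌊x * 2 ^ n⌋₊ / 2 ^ (n - i) = ⌊x * 2 ^ i⌋₊ := by
  have h := Nat.floor_div_natCast (x * 2 ^ n) (2 ^ (n - i))
  rw [← h]
  congr 1
  obtain ⟨k, rfl⟩ := Nat.exists_eq_add_of_le hi
  push_cast
  rw [pow_add]
  field_simp
  simp

theorem bits_eq_natBits {x : ℝ} (hx : 0 ≤ x) (n : ℕ) : bits x n = natBits ⌊x * 2 ^ n⌋₊ n := by
  refine List.map_congr_left fun i hi => ?_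
  have hi := List.mem_range.1 hi
  rw [rdigit_eq hx, ← floor_mul_two_pow_div (Nat.succ_le_of_lt hi)]
  rw [show n - i.succ = n - 1 - i by omega]

theorem listVal_bits {x : ℝ} (hx : 0 ≤ x) (hx1 : x < 1) (n : ℕ) :
    listVal (bits x n) = ⌊x * 2 ^ n⌋₊ := by
  induction n with
  | zero => simp [bits, listVal, Nat.floor_eq_zero.2 hx1]
  | succ n ih =>
    have h : bits x (n + 1) = bits x n ++ [rdigit x n] := by simp [bits, List.range_succ]
    rw [h, listVal, List.foldl_append, ← listVal, ih, rdigit_eq hx,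
      ← floor_mul_two_pow_div (Nat.le_succ n)]
    generalize ⌊x * 2 ^ n.succ⌋₊ = v
    rcases Nat.mod_two_eq_zero_or_one v with h | h <;> simp [h] <;> omega

theorem Kcond_le_iff (M : CondPFMachine) (σ τ : List Bool) (c : ℕ) :
    Kcond M σ τ ≤ c ↔ ∃ p : List Bool, p.length ≤ c ∧ σ ∈ M.f p τ := by
  constructor
  · intro h
    have hlt : Kcond M σ τ < ((c + 1 : ℕ) : ℕ∞) :=
      h.trans_lt (by exact_mod_cast Nat.lt_succ_self c)
    obtain ⟨⟨p, hp⟩, h⟩ := iInf_lt_iff.1 hlt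
    exact ⟨p, Nat.lt_succ_iff.1 (by exact_mod_cast h), hp⟩
  · rintro ⟨p, h, hp⟩
    exact (iInf_le _ (⟨p, hp⟩ : {p : List Bool // σ ∈ M.f p τ})).trans (by exact_mod_cast h)

theorem Partrec.exists_stages {α σ : Type*} [Primcodable α] [Primcodable σ] {f : α →. σ}
    (hf : Partrec f) : ∃ g : ℕ → α → Option σ, Computable₂ g ∧
      (∀ t a b, g t a = some b → b ∈ f a) ∧
      ∀ a b, b ∈ f a → ∃ t₀, ∀ t ≥ t₀, g t a = some b := by
  obtain ⟨c, hc⟩ := Nat.Partrec.Code.exists_code.1 hf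
  have hev : ∀ a, c.eval (encode a) = (f a).map encode := fun a => by
    rw [hc]; simp
  refine ⟨fun t a => (c.evaln t (encode a)).bind decode, ?_, ?_, ?_⟩
  · refine Primrec₂.to_comp (f := fun t a => (c.evaln t (encode a)).bind decode)
      (Primrec.option_bind (Nat.Partrec.Code.primrec_evaln.comp
      (Primrec.pair (Primrec.pair Primrec.fst (Primrec.const c))
        (Primrec.encode.comp Primrec.snd))) (Primrec.decode.comp Primrec.snd).to₂)
  · intro t a b h
    obtain ⟨n, hn, hb⟩ := Option.bind_eq_some_iff.1 h
    have := Nat.Partrec.Code.evaln_sound (Option.mem_def.2 hn)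
    rw [hev, Part.mem_map_iff] at this
    obtain ⟨b', hb', rfl⟩ := this
    rw [encodek] at hb
    rwa [← Option.some_inj.1 hb]
  · intro a b hb
    have : encode b ∈ c.eval (encode a) := by
      rw [hev]; exact Part.mem_map _ hb
    obtain ⟨t₀, ht₀⟩ := Nat.Partrec.Code.evaln_complete.1 this
    refine ⟨t₀, fun t ht => ?_⟩
    have := Option.mem_def.1 (Nat.Partrec.Code.evaln_mono ht ht₀)
    simp [this]

theorem LeftCE.exists_strictMono {x : ℝ} (hx : LeftCE x) : ∃ q : ℕ → ℚ, Computable q ∧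
    StrictMono q ∧ (∀ n, (q n : ℝ) < x) ∧
      Filter.Tendsto (fun n => (q n : ℝ)) Filter.atTop (nhds x) := by
  obtain ⟨q, hq, hm, ht⟩ := hx
  have hle : ∀ n, (q n : ℝ) ≤ x := fun n =>
    Monotone.ge_of_tendsto (fun i j h => by exact_mod_cast hm h) ht n
  refine ⟨fun n => q n - 1 / 2 ^ n, hq.rat_sub (Computable.rat_inv_two_pow .id),
    strictMono_nat_of_lt_succ fun n => ?_, fun n => ?_, ?_⟩
  · have h1 := hm (Nat.le_succ n)
    have h2 : (1 : ℚ) / 2 ^ (n + 1) < 1 / 2 ^ n := by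
      rw [pow_succ]; field_simp; norm_num
    linarith
  · have h2 : (0 : ℝ) < 1 / 2 ^ n := by positivity
    push_cast
    linarith [hle n]
  · have h2 : Filter.Tendsto (fun n : ℕ => (1 : ℝ) / 2 ^ n) Filter.atTop (nhds 0) := by
      simpa using tendsto_pow_atTop_nhds_zero_of_lt_one (r := (1 / 2 : ℝ)) (by norm_num)
        (by norm_num)
    simpa using ht.sub h2

section Solovay

/-- Stage `s` of the Kučera–Slaman construction: the right end of the last interval
of the test, and the value of `a` when it was chosen. -/
def testState (a b : ℕ → ℚ) (ε : ℚ) : ℕ → ℚ × ℚ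
  | 0 => (b 0, a 0)
  | s + 1 =>
    if (testState a b ε s).1 < b s then
      (b s + ε * (a s - (testState a b ε s).2), a s)
    else testState a b ε s

/-- The interval of the test added at stage `s`. -/
def testInterval (a b : ℕ → ℚ) (ε : ℚ) (s : ℕ) : ℚ × ℚ :=
  if (testState a b ε s).1 < b s then
    (b s, b s + 2 * (ε * (a s - (testState a b ε s).2)))
  else (0, 0)

variable {a b : ℕ → ℚ}

theorem Computable.testState (ha : Computable a) (hb : Computable b) {α : Type*} [Primcodable α]
    {ε : α → ℚ} (hε : Computable ε) :
    Computable₂ fun x s => testState a b (ε x) s := by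
  have h : Computable₂ fun (p : α × ℕ) (x : ℕ × (ℚ × ℚ)) =>
      bif decide (x.2.1 < b x.1) then (b x.1 + ε p.1 * (a x.1 - x.2.2), a x.1) else x.2 := by
    have hs : Computable fun y : (α × ℕ) × ℕ × (ℚ × ℚ) => y.2.1 :=
      Computable.fst.comp Computable.snd
    have hst : Computable fun y : (α × ℕ) × ℕ × (ℚ × ℚ) => y.2.2 :=
      Computable.snd.comp Computable.snd
    exact Computable.cond ((Computable.fst.comp hst).rat_lt (hb.comp hs))
      (((hb.comp hs).rat_add ((hε.comp (Computable.fst.comp Computable.fst)).rat_mul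
        ((ha.comp hs).rat_sub (Computable.snd.comp hst)))).pair (ha.comp hs)) hst
  refine (Computable.nat_rec (f := fun p : α × ℕ => p.2) (g := fun _ => (b 0, a 0))
    Computable.snd (.const _) h).of_eq ?_
  rintro ⟨x, s⟩
  induction s with
  | zero => rfl
  | succ s ih =>
    simp only at ih ⊢
    rw [ih, _root_.testState]
    simp only [Bool.cond_decide]

theorem Computable.testInterval (ha : Computable a) (hb : Computable b) {α : Type*}
    [Primcodable α] {ε : α → ℚ} (hε : Computable ε) :
    Computable₂ fun x s => testInterval a b (ε x) s := by
  have hst := Computable.testState ha hb hε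
  have hst1 : Computable fun p : α × ℕ => _root_.testState a b (ε p.1) p.2 := hst
  have ha' : Computable fun p : α × ℕ => a p.2 := ha.comp Computable.snd
  have hb' : Computable fun p : α × ℕ => b p.2 := hb.comp Computable.snd
  refine (Computable.cond ((Computable.fst.comp hst1).rat_lt hb')
    (hb'.pair (hb'.rat_add ((Computable.const (2 : ℚ)).rat_mul
      ((hε.comp Computable.fst).rat_mul (ha'.rat_sub (Computable.snd.comp hst1))))))
    (.const (0, 0))).of_eq ?_
  rintro ⟨x, s⟩
  simp only [Bool.cond_decide, _root_.testInterval]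

theorem testState_snd_le (ha : Monotone a) (ε : ℚ) (s : ℕ) : (testState a b ε s).2 ≤ a s := by
  induction s with
  | zero => simp [testState]
  | succ s ih =>
    rw [testState]
    split_ifs
    · exact ha s.le_succ
    · exact ih.trans (ha s.le_succ)

theorem testState_snd_mono (ha : Monotone a) (ε : ℚ) :
    Monotone fun s => (testState a b ε s).2 := by
  refine monotone_nat_of_le_succ fun s => ?_
  rw [testState]
  split_ifs
  · exact testState_snd_le ha ε s
  · exact le_rfl

theorem testState_growth {ε : ℚ} {s m : ℕ} (h : s ≤ m) :
    ε * ((testState a b ε m).2 - (testState a b ε s).2) ≤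
      (testState a b ε m).1 - (testState a b ε s).1 := by
  induction m, h using Nat.le_induction with
  | base => simp
  | succ m _ ih =>
    rw [testState]
    split_ifs with h
    · linarith
    · exact ih

theorem le_testState_fst (ha : Monotone a) {ε : ℚ} (hε : 0 ≤ ε) (s : ℕ) :
    b s ≤ (testState a b ε (s + 1)).1 := by
  rw [testState]
  split_ifs with h
  · have := mul_nonneg hε (sub_nonneg.2 (testState_snd_le (b := b) ha ε s))
    simpa using this
  · exact not_lt.1 h

theorem testInterval_length (ε : ℚ) (s : ℕ) :
    (testInterval a b ε s).2 - (testInterval a b ε s).1 =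
      2 * ε * ((testState a b ε (s + 1)).2 - (testState a b ε s).2) := by
  rw [testInterval, testState]
  split_ifs <;> simp
  ring

variable {α β : ℝ}

theorem volume_testInterval_le (ha : Monotone a) (haα : ∀ s, (a s : ℝ) < α) {ε : ℚ}
    (hε : 0 ≤ ε) :
    MeasureTheory.volume (⋃ s : ℕ, Set.Ioo ((testInterval a b ε s).1 : ℝ)
      ((testInterval a b ε s).2 : ℝ)) ≤ ENNReal.ofReal (2 * ε * (α - a 0)) := by
  have hε' : (0 : ℝ) ≤ ε := by exact_mod_cast hε
  refine (MeasureTheory.measure_iUnion_le _).trans ?_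
  refine ENNReal.tsum_le_of_sum_range_le fun N => ?_
  have h : ∀ s, MeasureTheory.volume (Set.Ioo ((testInterval a b ε s).1 : ℝ)
      ((testInterval a b ε s).2 : ℝ)) = ENNReal.ofReal
        (2 * ε * ((testState a b ε (s + 1)).2 - (testState a b ε s).2)) := fun s => by
    rw [Real.volume_Ioo]
    congr 1
    exact_mod_cast testInterval_length ε s
  simp only [h]
  rw [← ENNReal.ofReal_sum_of_nonneg, ← Finset.mul_sum,
    Finset.sum_range_sub (fun s => ((testState a b ε s).2 : ℝ))]
  · refine ENNReal.ofReal_le_ofReal (mul_le_mul_of_nonneg_left ?_ (by positivity))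
    have : ((testState a b ε N).2 : ℝ) ≤ a N := by exact_mod_cast testState_snd_le ha ε N
    have h0 : (testState a b ε 0).2 = a 0 := rfl
    rw [h0]
    linarith [haα N]
  · intro s _
    have : ((testState a b ε s).2 : ℝ) ≤ (testState a b ε (s + 1)).2 := by
      exact_mod_cast testState_snd_mono ha ε s.le_succ
    have := sub_nonneg.2 this
    positivity

theorem testState_fst_lt (ha : Monotone a) (hbβ : ∀ s, (b s : ℝ) < β) {ε : ℚ} (hε : 0 < ε)
    (h : β ∉ ⋃ s : ℕ, Set.Ioo ((testInterval a b ε s).1 : ℝ) ((testInterval a b ε s).2 : ℝ))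
    (s : ℕ) : ((testState a b ε s).1 : ℝ) < β := by
  induction s with
  | zero => exact hbβ 0
  | succ s ih =>
    rw [testState]
    split_ifs with hlt
    · have h1 : β ∉ Set.Ioo ((testInterval a b ε s).1 : ℝ) ((testInterval a b ε s).2 : ℝ) :=
        fun h' => h (Set.mem_iUnion.2 ⟨s, h'⟩)
      rw [testInterval, if_pos hlt, Set.mem_Ioo, not_and, not_lt] at h1
      have h2 := h1 (hbβ s)
      have h3 := hbβ s
      have h4 : (0 : ℝ) ≤ ε * (a s - (testState a b ε s).2) := by
        have := mul_nonneg hε.le (sub_nonneg.2 (testState_snd_le (b := b) ha ε s))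
        exact_mod_cast this
      push_cast at h2 ⊢
      rcases h4.eq_or_lt with h5 | h5 <;> linarith
    · exact ih

theorem exists_le_testState_snd (ha : Monotone a)
    (hb : Filter.Tendsto (fun n => (b n : ℝ)) Filter.atTop (nhds β)) {ε : ℚ}
    (h : ∀ s, ((testState a b ε s).1 : ℝ) < β) (N : ℕ) :
    ∃ m ≥ N, a N ≤ (testState a b ε m).2 := by
  by_contra! hcon
  have hconst : ∀ m ≥ N, (testState a b ε m).1 = (testState a b ε N).1 := by
    intro m hm
    induction m, hm using Nat.le_induction with
    | base => rfl
    | succ m hm ih =>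
      have h1 := hcon (m + 1) (hm.trans m.le_succ)
      rw [testState] at h1 ⊢
      split_ifs at h1 ⊢ with h2
      · exact absurd (ha hm) (not_le.2 h1)
      · exact ih
  obtain ⟨m, hm, hm'⟩ := ((hb.eventually (lt_mem_nhds (h N))).and
    (Filter.eventually_ge_atTop N)).exists
  have h2 : (testState a b ε m).1 < b m := by
    rw [hconst m hm']; exact_mod_cast hm
  have h1 := hcon (m + 1) (hm'.trans m.le_succ)
  rw [testState, if_pos h2] at h1
  exact absurd (ha hm') (not_le.2 h1)

/-- A Martin-Löf random left-c.e. real is Solovay complete, in terms of approximations. -/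
theorem MLRandom.exists_approx (hβ : MLRandom β)
    (hac : Computable a) (ha : StrictMono a) (haα : ∀ n, (a n : ℝ) < α)
    (hat : Filter.Tendsto (fun n => (a n : ℝ)) Filter.atTop (nhds α))
    (hbc : Computable b) (hbβ : ∀ n, (b n : ℝ) < β)
    (hbt : Filter.Tendsto (fun n => (b n : ℝ)) Filter.atTop (nhds β)) :
    ∃ l : ℕ → ℚ, Computable l ∧ ∃ C : ℕ, ∀ s, (l s : ℝ) ≤ α ∧ α - l s ≤ C * (β - b s) := by
  have hm := ha.monotone
  have hpos : 0 < α - a 0 := sub_pos.2 (haα 0)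
  obtain ⟨δ, hδ0, hδ⟩ := exists_rat_btwn (show (0 : ℝ) < 1 / (2 * (α - a 0)) by positivity)
  have hδ0' : 0 < δ := by exact_mod_cast hδ0
  set ε : ℕ → ℚ := fun n => δ * (1 / 2 ^ n) with hε
  have hεc : Computable ε := (Computable.const δ).rat_mul (Computable.rat_inv_two_pow .id)
  have hεpos : ∀ n, 0 < ε n := fun n => by positivity
  have hmem : ∃ n, β ∉ ⋃ s : ℕ, Set.Ioo ((testInterval a b (ε n) s).1 : ℝ)
      ((testInterval a b (ε n) s).2 : ℝ) := by
    have := hβ (fun n s => testInterval a b (ε n) s) (Computable.testInterval hac hbc hεc)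
      (fun n => (volume_testInterval_le hm haα (hεpos n).le).trans ?_)
    · simpa only [Set.mem_iInter, not_forall] using this
    · have h1 : (2 : ENNReal) ^ (-(n : ℤ)) = ENNReal.ofReal (1 / 2 ^ n) := by
        rw [ENNReal.zpow_neg, one_div, ENNReal.ofReal_inv_of_pos (by positivity),
          ENNReal.ofReal_pow (by norm_num)]
        simp
      rw [h1]
      refine ENNReal.ofReal_le_ofReal ?_
      rw [lt_div_iff₀ (by positivity)] at hδ
      have h2 : (0 : ℝ) < 1 / 2 ^ n := by positivity
      rw [hε]
      push_cast
      calc 2 * (δ * (1 / 2 ^ n)) * (α - a 0) = (δ * (2 * (α - a 0))) * (1 / 2 ^ n : ℝ) := by ring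
        _ ≤ 1 * (1 / 2 ^ n) := by gcongr
        _ = _ := one_mul _
  obtain ⟨n, hn⟩ := hmem
  have hlt := testState_fst_lt hm hbβ (hεpos n) hn
  have hεR : (0 : ℝ) < ε n := by exact_mod_cast hεpos n
  refine ⟨fun s => (testState a b (ε n) (s + 1)).2, ?_, ⌈((ε n : ℝ))⁻¹⌉₊, fun s => ⟨?_, ?_⟩⟩
  · exact Computable.snd.comp ((Computable.testState hac hbc (Computable.const (α := Unit)
      (ε n))).comp (.const ()) Computable.succ)
  · exact le_trans (by exact_mod_cast testState_snd_le hm (ε n) (s + 1)) (haα (s + 1)).le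
  · have key : ε n * (α - (testState a b (ε n) (s + 1)).2) ≤ β - b s := by
      have h0 : (b s : ℝ) ≤ (testState a b (ε n) (s + 1)).1 := by
        exact_mod_cast le_testState_fst hm (hεpos n).le s
      refine le_of_tendsto (f := fun N => (ε n : ℝ) * (a N - (testState a b (ε n) (s + 1)).2))
        ((hat.sub_const _).const_mul _) ?_
      filter_upwards [Filter.eventually_ge_atTop (s + 1)] with N hN
      obtain ⟨m, hm1, hm2⟩ := exists_le_testState_snd hm hbt hlt N
      have h1 : (ε n : ℝ) * ((testState a b (ε n) m).2 - (testState a b (ε n) (s + 1)).2) ≤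
          (testState a b (ε n) m).1 - (testState a b (ε n) (s + 1)).1 := by
        exact_mod_cast testState_growth (a := a) (b := b) (hN.trans hm1)
      have h2 : (a N : ℝ) ≤ (testState a b (ε n) m).2 := by exact_mod_cast hm2
      have h3 := mul_le_mul_of_nonneg_left h2 hεR.le
      linarith [hlt m]
    have hβs : 0 ≤ β - b s := sub_nonneg.2 (hbβ s).le
    calc α - (testState a b (ε n) (s + 1)).2
        = (ε n : ℝ)⁻¹ * (ε n * (α - (testState a b (ε n) (s + 1)).2)) := by
          field_simp
      _ ≤ (ε n : ℝ)⁻¹ * (β - b s) := by gcongr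
      _ ≤ _ := by gcongr; exact Nat.le_ceil _

end Solovay

/-- The machine which, given the first bits `τ` of `β`, finds a stage `s` at which `b s` is
close to `β`, and adds to the first bits of `l s` a number described by the program. -/
noncomputable def approxMachine (b l : ℕ → ℚ) (hb : Computable b) (hl : Computable l) (L : ℕ) :
    CondPFMachine where
  f p τ := (Nat.rfind ((fun s => decide (p.length = L) &&
      decide ((listVal τ : ℚ) < b s * 2 ^ τ.length + 1) : ℕ → Bool) : ℕ →. Bool)).map fun s =>
    natBits (ratPos (l s) * 2 ^ τ.length / (l s).den + p.idxOf false) τ.length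
  partrec := by
    have hlen : Computable fun x : (List Bool × List Bool) × ℕ => x.1.2.length :=
      Computable.list_length.comp (Computable.snd.comp Computable.fst)
    have hpow : Computable fun x : (List Bool × List Bool) × ℕ => 2 ^ x.1.2.length :=
      (Computable.const 2).nat_pow hlen
    have hls : Computable fun x : (List Bool × List Bool) × ℕ => l x.2 :=
      hl.comp Computable.snd
    refine Partrec.map (Partrec.rfind (Computable₂.partrec₂ (f := fun (x : List Bool × List Bool)
      (s : ℕ) => decide (x.1.length = L) &&
        decide ((listVal x.2 : ℚ) < b s * 2 ^ x.2.length + 1)) ?_)) ?_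
    · refine Computable.bool_and (Computable.nat_eq (Computable.list_length.comp
        (Computable.fst.comp Computable.fst)) (.const L)) (Computable.rat_lt
          (primrec_listVal.to_comp.comp (Computable.snd.comp Computable.fst)).rat_natCast ?_)
      exact (((hb.comp Computable.snd).rat_mul hpow.rat_natCast).rat_add (.const 1)).of_eq
        fun x => by push_cast; rfl
    · refine primrec_natBits.to_comp.comp (((((computable_ratPos.comp hls).nat_mul hpow).nat_div
        (computable_den.comp hls)).nat_add (Primrec.list_idxOf.to_comp.comp (.const false)
          (Computable.fst.comp Computable.fst)))) hlen
  prefixFree τ := by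
    have h : ∀ p : List Bool, (Part.Dom ((Nat.rfind ((fun s => decide (p.length = L) &&
        decide ((listVal τ : ℚ) < b s * 2 ^ τ.length + 1) : ℕ → Bool) : ℕ →. Bool)).map fun s =>
        natBits (ratPos (l s) * 2 ^ τ.length / (l s).den + p.idxOf false) τ.length)) →
        p.length = L := by
      intro p hp
      obtain ⟨y, hy⟩ := Part.dom_iff_mem.1 hp
      obtain ⟨s, hs, -⟩ := (Part.mem_map_iff _).1 hy
      have := Nat.rfind_spec hs
      replace this := Part.mem_some_iff.1 this
      exact of_decide_eq_true (Bool.and_eq_true_iff.1 this.symm).1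
    intro σ hσ ρ hρ hpre
    exact hpre.eq_of_length ((h σ hσ).trans (h ρ hρ).symm)

theorem Kcond_le_of_random {α β : ℝ} (hα : α ∈ Set.Ioo (0 : ℝ) 1) (hβ : β ∈ Set.Ioo (0 : ℝ) 1)
    (hαc : LeftCE α) (hβc : LeftCE β) (hr : MLRandom β) :
    ∃ N : CondPFMachine, ∃ c : ℕ, ∀ n, Kcond N (bits α n) (bits β n) ≤ c := by
  obtain ⟨a, hac, ha, haα, hat⟩ := hαc.exists_strictMono
  obtain ⟨b, hbc, -, hbβ, hbt⟩ := hβc.exists_strictMono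
  obtain ⟨l, hlc, C, hl⟩ := hr.exists_approx hac ha haα hat hbc hbβ hbt
  refine ⟨approxMachine b l hbc hlc (2 * C), 2 * C, fun n => ?_⟩
  rw [Kcond_le_iff]
  have hpow : (0 : ℝ) < 2 ^ n := by positivity
  have hV := listVal_bits hβ.1.le hβ.2 n
  have hex : ∃ s, decide ((listVal (bits β n) : ℚ) < b s * 2 ^ (bits β n).length + 1) = true := by
    rw [hV, length_bits]
    have h1 : ((⌊β * 2 ^ n⌋₊ : ℝ)) < β * 2 ^ n + 1 :=
      (Nat.floor_le (by have := hβ.1; positivity)).trans_lt (lt_add_one _)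
    obtain ⟨s, hs⟩ := (((hbt.mul_const (2 ^ n : ℝ)).add_const 1).eventually
      (lt_mem_nhds h1)).exists
    exact ⟨s, decide_eq_true (by exact_mod_cast hs)⟩
  set s := Nat.find hex with hs_def
  have hs := of_decide_eq_true (Nat.find_spec hex)
  rw [← hs_def, hV, length_bits] at hs
  have hs' : ((⌊β * 2 ^ n⌋₊ : ℝ)) < b s * 2 ^ n + 1 := by exact_mod_cast hs
  set R := ratPos (l s) * 2 ^ n / (l s).den with hR_def
  have hden : (0 : ℝ) < (l s).den := by exact_mod_cast (l s).pos
  have hls : (l s : ℝ) = ((ratPos (l s) : ℝ) - ratNeg (l s)) / (l s).den := by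
    exact_mod_cast congrArg (Rat.cast : ℚ → ℝ) (rat_eq_frac (l s))
  have hR : R = ⌊(ratPos (l s) : ℝ) / (l s).den * 2 ^ n⌋₊ := by
    rw [hR_def, ← Nat.floor_div_eq_div (K := ℝ)]
    congr 1
    push_cast
    ring
  have hRle : R ≤ ⌊α * 2 ^ n⌋₊ := by
    rw [hR]
    refine Nat.floor_le_floor ?_
    gcongr
    rcases le_total 0 (l s).num with h | h
    · have h0 : ratNeg (l s) = 0 := by unfold ratNeg; omega
      rw [h0] at hls
      refine le_trans (le_of_eq ?_) (hl s).1
      simpa using hls.symm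
    · have h0 : ratPos (l s) = 0 := by unfold ratPos; omega
      simpa [h0] using hα.1.le
  have hAR : ⌊α * 2 ^ n⌋₊ - R ≤ 2 * C := by
    have h1 : (⌊α * 2 ^ n⌋₊ : ℝ) ≤ α * 2 ^ n := Nat.floor_le (by have := hα.1; positivity)
    have h2 : (l s : ℝ) * 2 ^ n < R + 1 := by
      rw [hR]
      refine lt_of_le_of_lt ?_ (Nat.lt_floor_add_one _)
      gcongr
      rw [hls]
      gcongr
      have : (0 : ℝ) ≤ ratNeg (l s) := by positivity
      linarith
    have h3 : β * 2 ^ n < ⌊β * 2 ^ n⌋₊ + 1 := Nat.lt_floor_add_one _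
    have h4 : (β - b s) * 2 ^ n ≤ 2 := by linarith
    have h5 : (α - l s) * 2 ^ n ≤ C * 2 := by
      calc (α - l s) * 2 ^ n ≤ (C * (β - b s)) * 2 ^ n := by gcongr; exact (hl s).2
        _ = C * ((β - b s) * 2 ^ n) := by ring
        _ ≤ C * 2 := by gcongr
    have h6 : (⌊α * 2 ^ n⌋₊ : ℝ) < (R + 2 * C + 1 : ℕ) := by
      push_cast; linarith
    have h7 := Nat.cast_lt.1 h6
    omega
  set j := ⌊α * 2 ^ n⌋₊ - R with hj
  have hidx : (List.replicate j true ++ List.replicate (2 * C - j) false).idxOf false = j := by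
    rw [List.idxOf_append_of_notMem (by simp)]
    rcases Nat.eq_zero_or_pos (2 * C - j) with h | h
    · simp [h]
    · obtain ⟨k, hk⟩ := Nat.exists_eq_succ_of_ne_zero h.ne'
      simp [hk, List.replicate_succ]
  have hlen : (List.replicate j true ++ List.replicate (2 * C - j) false).length = 2 * C := by
    simp; omega
  refine ⟨_, hlen.le, ?_⟩
  refine (Part.mem_map_iff _).2 ⟨s, ?_, ?_⟩
  · refine Nat.mem_rfind.2 ⟨Part.mem_some_iff.2 ?_, fun {m} hm => Part.mem_some_iff.2 ?_⟩
    · simp only [decide_eq_true hlen, Bool.true_and]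
      exact (Nat.find_spec hex).symm
    · have := Nat.find_min hex hm
      simp only [decide_eq_true hlen, Bool.true_and]
      exact (Bool.eq_false_iff.2 this).symm
  · rw [hidx, length_bits, ← hR_def, hj, bits_eq_natBits hα.1.le]
    congr 1
    omega

/-- The dyadic interval `[v / 2 ^ n, (v + 1) / 2 ^ n)` is seen at stage `n` to be contained in
one of the intervals `I k`. -/
def DyadicCovered (I : ℕ → ℚ × ℚ) (v n : ℕ) : Prop :=
  ∃ k < n + 1, (I k).1 * (2 ^ n : ℕ) < v ∧ ((v + 1 : ℕ) : ℚ) < (I k).2 * (2 ^ n : ℕ)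

/-- The dyadic interval `[v / 2 ^ n, (v + 1) / 2 ^ n)` is covered, but no larger dyadic interval
around it is. -/
def DyadicMinimal (I : ℕ → ℚ × ℚ) (v n : ℕ) : Prop :=
  DyadicCovered I v n ∧ ¬ ∃ i < n, DyadicCovered I (v / 2 ^ (n - i)) i

theorem Computable.dyadicCovered {α : Type*} [Primcodable α] {I : ℕ → ℕ → ℚ × ℚ}
    (hI : Computable₂ I) {m v n : α → ℕ} (hm : Computable m) (hv : Computable v)
    (hn : Computable n) : Computable fun a => decide (DyadicCovered (I (m a)) (v a) (n a)) := by
  refine (Computable.exists_lt (p := fun a k => (I (m a) k).1 * (2 ^ n a : ℕ) < v a ∧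
    ((v a + 1 : ℕ) : ℚ) < (I (m a) k).2 * (2 ^ n a : ℕ)) ?_ (Computable.succ.comp hn)).of_eq
      fun a => decide_eq_decide.2 Iff.rfl
  have hIk : Computable fun x : α × ℕ => I (m x.1) x.2 :=
    hI.comp (hm.comp Computable.fst) Computable.snd
  have hpow : Computable fun x : α × ℕ => ((2 ^ n x.1 : ℕ) : ℚ) :=
    ((Computable.const 2).nat_pow (hn.comp Computable.fst)).rat_natCast
  have hv' : Computable fun x : α × ℕ => v x.1 := hv.comp Computable.fst
  refine (Computable.bool_and
    (((Computable.fst.comp hIk).rat_mul hpow).rat_lt hv'.rat_natCast)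
    (((Computable.succ.comp hv').rat_natCast).rat_lt
      ((Computable.snd.comp hIk).rat_mul hpow))).of_eq fun x => ?_
  rw [← Bool.decide_and]
  exact decide_eq_decide.2 Iff.rfl

theorem Computable.dyadicMinimal {α : Type*} [Primcodable α] {I : ℕ → ℕ → ℚ × ℚ}
    (hI : Computable₂ I) {m v n : α → ℕ} (hm : Computable m) (hv : Computable v)
    (hn : Computable n) : Computable fun a => decide (DyadicMinimal (I (m a)) (v a) (n a)) := by
  have h := Computable.exists_lt
    (p := fun a i => DyadicCovered (I (m a)) (v a / 2 ^ (n a - i)) i)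
    (Computable.dyadicCovered hI (hm.comp Computable.fst)
      ((hv.comp Computable.fst).nat_div ((Computable.const 2).nat_pow
        ((hn.comp Computable.fst).nat_sub Computable.snd))) Computable.snd) hn
  refine ((Computable.dyadicCovered hI hm hv hn).bool_and h.bool_not).of_eq fun a => ?_
  rw [DyadicMinimal, Bool.decide_and, decide_not]

theorem floor_mul_two_pow_eq {x : ℝ} {v n : ℕ}
    (hx : x ∈ Set.Ico ((v : ℝ) / 2 ^ n) ((v + 1) / 2 ^ n)) : ⌊x * 2 ^ n⌋₊ = v := by
  have h : (0 : ℝ) < 2 ^ n := by positivity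
  rw [Nat.floor_eq_iff]
  · exact ⟨(div_le_iff₀ h).1 hx.1, (lt_div_iff₀ h).1 hx.2⟩
  · exact mul_nonneg (le_trans (by positivity) hx.1) h.le

theorem DyadicMinimal.le_of_mem {I : ℕ → ℚ × ℚ} {v n v' n' : ℕ} (h : DyadicMinimal I v n)
    (h' : DyadicMinimal I v' n') {x : ℝ}
    (hx : x ∈ Set.Ico ((v : ℝ) / 2 ^ n) ((v + 1) / 2 ^ n))
    (hx' : x ∈ Set.Ico ((v' : ℝ) / 2 ^ n') ((v' + 1) / 2 ^ n')) : n ≤ n' := by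
  by_contra! hlt
  refine h.2 ⟨n', hlt, ?_⟩
  rw [← floor_mul_two_pow_eq hx, floor_mul_two_pow_div hlt.le, floor_mul_two_pow_eq hx']
  exact h'.1

theorem DyadicCovered.subset {I : ℕ → ℚ × ℚ} {v n : ℕ} (h : DyadicCovered I v n) :
    Set.Ico ((v : ℝ) / 2 ^ n) ((v + 1) / 2 ^ n) ⊆
      ⋃ k : ℕ, Set.Ioo ((I k).1 : ℝ) ((I k).2 : ℝ) := by
  obtain ⟨k, -, h1, h2⟩ := h
  have hp : (0 : ℝ) < 2 ^ n := by positivity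
  have h1' : ((I k).1 : ℝ) * 2 ^ n < v := by exact_mod_cast h1
  have h2' : (v + 1 : ℝ) < (I k).2 * 2 ^ n := by exact_mod_cast h2
  intro x hx
  exact Set.mem_iUnion.2 ⟨k, ((lt_div_iff₀ hp).2 h1').trans_le hx.1,
    hx.2.trans ((div_lt_iff₀ hp).2 h2')⟩

theorem tsum_dyadicMinimal_le (I : ℕ → ℚ × ℚ) :
    ∑' x : ℕ × ℕ, (if DyadicMinimal I x.1 x.2 then ((2 : ENNReal) ^ x.2)⁻¹ else 0) ≤
      MeasureTheory.volume (⋃ k : ℕ, Set.Ioo ((I k).1 : ℝ) ((I k).2 : ℝ)) := by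
  set S : Set (ℕ × ℕ) := {x | DyadicMinimal I x.1 x.2} with hS
  set J : S → Set ℝ := fun x => Set.Ico ((x.1.1 : ℝ) / 2 ^ x.1.2) ((x.1.1 + 1) / 2 ^ x.1.2)
  have hJ : ∀ x, MeasureTheory.volume (J x) = ((2 : ENNReal) ^ x.1.2)⁻¹ := fun x => by
    rw [Real.volume_Ico, ← sub_div, add_sub_cancel_left, one_div,
      ENNReal.ofReal_inv_of_pos (by positivity), ENNReal.ofReal_pow (by norm_num)]
    simp
  calc _ = ∑' x, S.indicator (fun x => ((2 : ENNReal) ^ x.2)⁻¹) x := by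
        simp only [Set.indicator_apply, hS, Set.mem_ofPred_eq]
    _ = ∑' x : S, MeasureTheory.volume (J x) := by
        simp only [hJ]
        exact (tsum_subtype S fun x => ((2 : ENNReal) ^ x.2)⁻¹).symm
    _ = MeasureTheory.volume (⋃ x, J x) := by
        refine (MeasureTheory.measure_iUnion ?_ fun x => measurableSet_Ico).symm
        intro x y hxy
        refine Set.disjoint_left.2 fun z hx hy => hxy ?_
        have hn : x.1.2 = y.1.2 :=
          le_antisymm (x.2.le_of_mem y.2 hx hy) (y.2.le_of_mem x.2 hy hx)
        have hv := floor_mul_two_pow_eq hx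
        rw [hn, floor_mul_two_pow_eq hy] at hv
        exact Subtype.ext (Prod.ext hv.symm hn)
    _ ≤ _ := MeasureTheory.measure_mono (Set.iUnion_subset fun x => x.2.1.subset)

theorem exists_dyadicMinimal {I : ℕ → ℚ × ℚ} {x : ℝ} (hx : 0 ≤ x)
    (h : x ∈ ⋃ k : ℕ, Set.Ioo ((I k).1 : ℝ) ((I k).2 : ℝ)) :
    ∃ n, DyadicMinimal I ⌊x * 2 ^ n⌋₊ n := by
  have hex : ∃ n, DyadicCovered I ⌊x * 2 ^ n⌋₊ n := by
    obtain ⟨k, h1, h2⟩ := Set.mem_iUnion.1 h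
    have hpow : Filter.Tendsto (fun n : ℕ => (2 : ℝ) ^ n) Filter.atTop Filter.atTop :=
      tendsto_pow_atTop_atTop_of_one_lt (by norm_num)
    obtain ⟨n, ⟨h3, h4⟩, hk⟩ := (((hpow.const_mul_atTop (sub_pos.2 h1)).eventually_gt_atTop 1).and
      ((hpow.const_mul_atTop (sub_pos.2 h2)).eventually_gt_atTop 1)).and
        (Filter.eventually_ge_atTop k) |>.exists
    have hf1 : (⌊x * 2 ^ n⌋₊ : ℝ) ≤ x * 2 ^ n := Nat.floor_le (by positivity)
    have hf2 : x * 2 ^ n < ⌊x * 2 ^ n⌋₊ + 1 := Nat.lt_floor_add_one _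
    have h5 : ((I k).1 : ℝ) * 2 ^ n < ⌊x * 2 ^ n⌋₊ := by linarith
    have h6 : (⌊x * 2 ^ n⌋₊ + 1 : ℝ) < (I k).2 * 2 ^ n := by linarith
    exact ⟨n, k, Nat.lt_succ_of_le hk, by exact_mod_cast h5, by exact_mod_cast h6⟩
  refine ⟨Nat.find hex, Nat.find_spec hex, ?_⟩
  rintro ⟨i, hi, hc⟩
  rw [floor_mul_two_pow_div hi.le] at hc
  exact Nat.find_min hex hi hc

/-- Starting at `1 / 4`, jump over the dyadic interval of length `2 / 2 ^ n s` around
`w s / 2 ^ n s` at each active stage `s` at which we are in this interval. -/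
def jumpSeq (act : ℕ → Bool) (n w : ℕ → ℕ) : ℕ → ℚ
  | 0 => 1 / 4
  | s + 1 =>
    if act s = true ∧ (w s : ℚ) ≤ jumpSeq act n w s * (2 ^ n s : ℕ) + 1 ∧
        jumpSeq act n w s * (2 ^ n s : ℕ) < (w s + 1 : ℕ) then
      jumpSeq act n w s + 2 * (1 / 2 ^ n s)
    else jumpSeq act n w s

section Jump

variable {act : ℕ → Bool} {n w : ℕ → ℕ}

theorem Computable.jumpSeq (ha : Computable act) (hn : Computable n) (hw : Computable w) :
    Computable (jumpSeq act n w) := by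
  have h : Computable₂ fun (_ : ℕ) (x : ℕ × ℚ) =>
      bif (act x.1 && (decide ((w x.1 : ℚ) ≤ x.2 * (2 ^ n x.1 : ℕ) + 1) &&
        decide (x.2 * (2 ^ n x.1 : ℕ) < ((w x.1 + 1 : ℕ) : ℚ)))) then
        x.2 + 2 * (1 / 2 ^ n x.1) else x.2 := by
    have hs : Computable fun y : ℕ × ℕ × ℚ => y.2.1 := Computable.fst.comp Computable.snd
    have hq : Computable fun y : ℕ × ℕ × ℚ => y.2.2 := Computable.snd.comp Computable.snd
    have hm : Computable fun y : ℕ × ℕ × ℚ => y.2.2 * ((2 ^ n y.2.1 : ℕ) : ℚ) :=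
      hq.rat_mul ((Computable.const 2).nat_pow (hn.comp hs)).rat_natCast
    exact Computable.cond ((ha.comp hs).bool_and
      (((hw.comp hs).rat_natCast.rat_le (hm.rat_add (.const 1))).bool_and
        (hm.rat_lt (Computable.succ.comp (hw.comp hs)).rat_natCast)))
      (hq.rat_add ((Computable.const (2 : ℚ)).rat_mul
        (Computable.rat_inv_two_pow (hn.comp hs)))) hq
  refine (Computable.nat_rec (f := fun s : ℕ => s) (g := fun _ => (1 / 4 : ℚ))
    Computable.id (.const _) h).of_eq ?_
  intro s
  induction s with
  | zero => rfl
  | succ s ih =>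
    simp only at ih ⊢
    rw [ih, _root_.jumpSeq, ← Bool.decide_and]
    by_cases h1 : act s = true
    · simp only [h1, Bool.true_and, Bool.cond_decide, true_and]
    · simp [h1]

theorem monotone_jumpSeq : Monotone (jumpSeq act n w) := by
  refine monotone_nat_of_le_succ fun s => ?_
  rw [jumpSeq]
  split_ifs
  · have : (0 : ℚ) ≤ 2 * (1 / 2 ^ n s) := by positivity
    linarith
  · exact le_rfl

theorem jumpSeq_succ_ge {s : ℕ} (ha : act s = true)
    (hs : (w s : ℚ) ≤ jumpSeq act n w s * 2 ^ n s + 1) :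
    (w s + 1 : ℚ) ≤ jumpSeq act n w (s + 1) * 2 ^ n s := by
  have hp : (0 : ℚ) < 2 ^ n s := by positivity
  rw [jumpSeq]
  split_ifs with h
  · rw [add_mul, mul_assoc, one_div, inv_mul_cancel₀ hp.ne']
    linarith
  · push_cast at h
    by_contra! h'
    exact h ⟨ha, hs, h'⟩

theorem jumpSeq_le {κ : Type*} {key : ℕ → κ} {N : κ → ℕ} (hn : ∀ s, n s = N (key s))
    {A : κ → Prop} (hA : ∀ s, act s = true → A (key s))
    (hw : ∀ s s', act s = true → act s' = true → key s = key s' → w s = w s')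
    (hsum : ∑' k, (if A k then 2 * ((2 : ENNReal) ^ N k)⁻¹ else 0) ≤ ENNReal.ofReal (1 / 4))
    (s : ℕ) : jumpSeq act n w s ≤ 1 / 2 := by
  set q := jumpSeq act n w with hq
  set T : Set ℕ := {s | act s = true ∧ (w s : ℚ) ≤ q s * 2 ^ n s + 1 ∧
    q s * 2 ^ n s < w s + 1} with hT
  have hinj : ∀ s ∈ T, ∀ s' ∈ T, key s = key s' → s' ≤ s := by
    intro s hs s' hs' hk
    by_contra! hlt
    have h1 := jumpSeq_succ_ge hs.1 hs.2.1
    have h2 := monotone_jumpSeq (act := act) (n := n) (w := w) (Nat.succ_le_of_lt hlt)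
    have h3 := hs'.2.2
    rw [← hw s s' hs.1 hs'.1 hk, hn s', ← hk, ← hn s] at h3
    have h4 : q (s + 1) * 2 ^ n s ≤ q s' * 2 ^ n s := by gcongr
    linarith
  have hstep : ∀ S, (q S : ℝ) = 1 / 4 + ∑ s ∈ (Finset.range S).filter (· ∈ T),
      2 * ((2 : ℝ) ^ n s)⁻¹ := by
    intro S
    induction S with
    | zero => simp [hq, jumpSeq]
    | succ S ih =>
      have hq1 : q (S + 1) = if S ∈ T then q S + 2 * (1 / 2 ^ n S) else q S :=
        if_congr (by push_cast; exact Iff.rfl) rfl rfl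
      rw [Finset.sum_filter, Finset.sum_range_succ, ← Finset.sum_filter, ← add_assoc, ← ih, hq1]
      split_ifs
      · push_cast
        ring
      · rw [add_zero]
  have hle : ENNReal.ofReal (∑ s ∈ (Finset.range s).filter (· ∈ T), 2 * ((2 : ℝ) ^ n s)⁻¹) ≤
      ENNReal.ofReal (1 / 4) := by
    rw [ENNReal.ofReal_sum_of_nonneg fun _ _ => by positivity]
    refine le_trans ?_ hsum
    have hinj' : Set.InjOn key ((Finset.range s).filter (· ∈ T) : Finset ℕ) := by
      intro i hi j hj hij
      have hi := (Finset.mem_filter.1 hi).2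
      have hj := (Finset.mem_filter.1 hj).2
      exact le_antisymm (hinj j hj i hi hij.symm) (hinj i hi j hj hij)
    refine le_trans (le_of_eq ?_) (ENNReal.sum_le_tsum
      (((Finset.range s).filter (· ∈ T)).image key))
    rw [Finset.sum_image hinj']
    refine Finset.sum_congr rfl fun i hi => ?_
    rw [if_pos (hA i (Finset.mem_filter.1 hi).2.1), ← hn, ENNReal.ofReal_mul (by norm_num),
      ENNReal.ofReal_inv_of_pos (by positivity), ENNReal.ofReal_pow (by norm_num)]
    simp
  have h1 := (ENNReal.ofReal_le_ofReal_iff (by norm_num)).1 hle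
  have h2 : (q s : ℝ) ≤ (1 / 2 : ℚ) := by
    rw [hstep s]; push_cast; linarith
  exact_mod_cast h2

end Jump

theorem tsum_weights_le {D : ℕ → ℕ × ℕ → Prop}
    (hD : ∀ m, ∑' x : ℕ × ℕ, (if D m x then ((2 : ENNReal) ^ x.2)⁻¹ else 0) ≤ 2 ^ (-(m : ℤ))) :
    ∑' k : ℕ × ℕ × ℕ × ℕ, (if k.2.1 < k.1 ∧ D (2 * k.1 + 4) k.2.2 then
      2 * ((2 : ENNReal) ^ k.2.2.2)⁻¹ else 0) ≤ ENNReal.ofReal (1 / 4) := by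
  have h1 : ∀ c, ∑' k : ℕ × ℕ × ℕ, (if k.1 < c ∧ D (2 * c + 4) k.2 then
      2 * ((2 : ENNReal) ^ k.2.2)⁻¹ else 0) ≤ (1 / 8) * (2⁻¹) ^ c := by
    intro c
    calc _ = ∑' e : ℕ, ∑' x : ℕ × ℕ, (if e < c ∧ D (2 * c + 4) x then
          2 * ((2 : ENNReal) ^ x.2)⁻¹ else 0) := ENNReal.tsum_prod'
      _ = ∑' e : ℕ, (if e < c then 2 * ∑' x : ℕ × ℕ, (if D (2 * c + 4) x then
          ((2 : ENNReal) ^ x.2)⁻¹ else 0) else 0) := by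
          refine tsum_congr fun e => ?_
          split_ifs with h
          · simp only [h, true_and, ← ENNReal.tsum_mul_left, mul_ite, mul_zero]
          · simp [h]
      _ = ∑ e ∈ Finset.range c, 2 * ∑' x : ℕ × ℕ, (if D (2 * c + 4) x then
          ((2 : ENNReal) ^ x.2)⁻¹ else 0) := by
          rw [tsum_eq_sum (s := Finset.range c)
            fun e he => if_neg fun h => he (Finset.mem_range.2 h)]
          exact Finset.sum_congr rfl fun e he => if_pos (Finset.mem_range.1 he)
      _ ≤ ∑ e ∈ Finset.range c, 2 * 2 ^ (-((2 * c + 4 : ℕ) : ℤ)) := by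
          gcongr; exact hD _
      _ = (c : ENNReal) * (2 * 2 ^ (-((2 * c + 4 : ℕ) : ℤ))) := by simp
      _ ≤ (2 ^ c : ℕ) * (2 * 2 ^ (-((2 * c + 4 : ℕ) : ℤ))) := by
          gcongr; exact Nat.lt_two_pow_self.le
      _ = (1 / 8) * (2⁻¹) ^ c := by
          rw [ENNReal.zpow_neg, zpow_natCast, ← ENNReal.toReal_eq_toReal_iff']
          · simp
            field_simp
            ring
          · finiteness
          · finiteness
  rw [ENNReal.tsum_prod']
  refine (ENNReal.tsum_le_tsum h1).trans ?_
  rw [ENNReal.tsum_mul_left, ENNReal.tsum_geometric, ENNReal.one_sub_inv_two, inv_inv]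
  rw [← ENNReal.toReal_le_toReal (by finiteness) (by finiteness)]
  simp
  norm_num

theorem exists_leftCE_Kcond_unbounded {β : ℝ} (hβ : β ∈ Set.Ioo (0 : ℝ) 1) (hr : ¬ MLRandom β)
    (M : CondPFMachine) : ∃ α ∈ Set.Ioo (0 : ℝ) 1, LeftCE α ∧
      ∀ c : ℕ, ∃ n, ¬ Kcond M (bits α n) (bits β n) ≤ c := by
  rw [MLRandom] at hr
  push Not at hr
  obtain ⟨I, hI, hvol, hmem⟩ := hr
  obtain ⟨g, hgc, hgs, hge⟩ := Partrec.exists_stages M.partrec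
  set dec : ℕ → (ℕ × ℕ × ℕ × ℕ) × ℕ := fun s =>
    ((decode s : Option ((ℕ × ℕ × ℕ × ℕ) × ℕ))).getD ((0, 0, 0, 0), 0) with hdec
  set prog : ℕ → List Bool := fun e => ((decode e : Option (List Bool))).getD [] with hprog
  set out : ℕ → Option (List Bool) := fun s =>
    g (dec s).2 (prog (dec s).1.2.1, natBits (dec s).1.2.2.1 (dec s).1.2.2.2) with hout
  set act : ℕ → Bool := fun s => decide ((dec s).1.2.1 < (dec s).1.1) &&
    (decide (DyadicMinimal (I (2 * (dec s).1.1 + 4)) (dec s).1.2.2.1 (dec s).1.2.2.2) &&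
      (out s).isSome) with hact
  set w : ℕ → ℕ := fun s => listVal ((out s).getD []) with hw
  set N : ℕ → ℕ := fun s => (dec s).1.2.2.2 with hN
  have hdecc : Computable dec := (Computable.decode).option_getD (.const _)
  have hc : Computable fun s => (dec s).1.1 := Computable.fst.comp (Computable.fst.comp hdecc)
  have hk : Computable fun s => (dec s).1.2 := Computable.snd.comp (Computable.fst.comp hdecc)
  have he : Computable fun s => (dec s).1.2.1 := Computable.fst.comp hk
  have hv : Computable fun s => (dec s).1.2.2.1 := Computable.fst.comp (Computable.snd.comp hk)
  have hNc : Computable N := Computable.snd.comp (Computable.snd.comp hk)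
  have hprogc : Computable prog := (Computable.decode).option_getD (.const _)
  have houtc : Computable out := hgc.comp (Computable.snd.comp hdecc)
    ((hprogc.comp he).pair (primrec_natBits.to_comp.comp hv hNc))
  have hactc : Computable act := (he.nat_lt hc).bool_and
    ((Computable.dyadicMinimal hI ((Computable.const 2).nat_mul hc |>.nat_add (.const 4)) hv
      hNc).bool_and (Primrec.option_isSome.to_comp.comp houtc))
  have hwc : Computable w := primrec_listVal.to_comp.comp (houtc.option_getD (.const []))
  have hact_iff : ∀ s, act s = true ↔ (dec s).1.2.1 < (dec s).1.1 ∧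
      DyadicMinimal (I (2 * (dec s).1.1 + 4)) (dec s).1.2.2.1 (dec s).1.2.2.2 ∧
        (out s).isSome = true := fun s => by
    simp only [hact, Bool.and_eq_true, decide_eq_true_eq]
  set q := jumpSeq act N w with hq
  have hqc : Computable q := Computable.jumpSeq hactc hNc hwc
  have hqm : Monotone q := monotone_jumpSeq
  have hqle : ∀ s, q s ≤ 1 / 2 := by
    refine jumpSeq_le (key := fun s => (dec s).1) (N := fun k => k.2.2.2)
      (A := fun k => k.2.1 < k.1 ∧ DyadicMinimal (I (2 * k.1 + 4)) k.2.2.1 k.2.2.2)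
      (fun s => rfl) (fun s hs => ?_) (fun s s' hs hs' hkey => ?_) ?_
    · exact ⟨((hact_iff s).1 hs).1, ((hact_iff s).1 hs).2.1⟩
    · obtain ⟨x, hx⟩ := Option.isSome_iff_exists.1 ((hact_iff s).1 hs).2.2
      obtain ⟨x', hx'⟩ := Option.isSome_iff_exists.1 ((hact_iff s').1 hs').2.2
      have h1 := hgs _ _ _ hx
      have h2 := hgs _ _ _ hx'
      rw [← show (dec s).1 = (dec s').1 from hkey] at h2
      have := Part.mem_unique h1 h2
      simp only [hw, hx, hx', this]
    · convert tsum_weights_le (D := fun m x => DyadicMinimal (I m) x.1 x.2)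
        fun m => (tsum_dyadicMinimal_le (I m)).trans (hvol m)
  have hqmR : Monotone fun s => (q s : ℝ) := fun i j h => Rat.cast_le.2 (hqm h)
  have hqleR : ∀ s, (q s : ℝ) ≤ 1 / 2 := fun s => by
    have h : (q s : ℝ) ≤ (1 / 2 : ℚ) := Rat.cast_le.2 (hqle s)
    simpa using h
  have hbdd : BddAbove (Set.range fun s => (q s : ℝ)) :=
    ⟨1 / 2, Set.forall_mem_range.2 hqleR⟩
  set α : ℝ := ⨆ s, (q s : ℝ) with hα
  have hqα : ∀ s, (q s : ℝ) ≤ α := le_ciSup hbdd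
  have htend : Filter.Tendsto (fun s => (q s : ℝ)) Filter.atTop (nhds α) :=
    tendsto_atTop_ciSup hqmR hbdd
  have hα0 : 0 < α := lt_of_lt_of_le (by norm_num [hq, jumpSeq]) (hqα 0)
  have hα1 : α < 1 := (ciSup_le hqleR).trans_lt (by norm_num)
  refine ⟨α, ⟨hα0, hα1⟩, ⟨q, hqc, hqm, htend⟩, fun c₀ => ?_⟩
  by_contra! hcon
  obtain ⟨c, hcb⟩ := ((List.finite_length_le Bool c₀).image encode).bddAbove
  obtain ⟨n, hn⟩ := exists_dyadicMinimal hβ.1.le (Set.mem_iInter.1 hmem (2 * (c + 1) + 4))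
  obtain ⟨p, hp, hpM⟩ := (Kcond_le_iff _ _ _ _).1 (hcon n)
  have hpc : encode p < c + 1 := Nat.lt_succ_of_le (hcb ⟨p, hp, rfl⟩)
  rw [bits_eq_natBits hβ.1.le] at hpM
  set v := ⌊β * 2 ^ n⌋₊
  obtain ⟨t₀, ht₀⟩ := hge (p, natBits v n) (bits α n) hpM
  have hpow : (0 : ℝ) < 2 ^ n := by positivity
  have hfl : (⌊α * 2 ^ n⌋₊ : ℝ) ≤ α * 2 ^ n := Nat.floor_le (by positivity)
  obtain ⟨s₀, hs₀⟩ := (((htend.mul_const ((2 : ℝ) ^ n)).add_const 1).eventually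
    (lt_mem_nhds (lt_of_le_of_lt hfl (lt_add_one _)))).exists
  obtain ⟨t, ht, hs⟩ : ∃ t ≥ t₀, s₀ ≤ encode ((c + 1, encode p, v, n), t) := by
    have hinj : Function.Injective fun t : ℕ => encode ((c + 1, encode p, v, n), t) :=
      fun t t' h => (Prod.mk.inj (encode_injective h)).2
    obtain ⟨t, h⟩ := ((Filter.eventually_ge_atTop t₀).and
      ((hinj.nat_tendsto_atTop).eventually_ge_atTop s₀)).exists
    exact ⟨t, h⟩
  set s := encode ((c + 1, encode p, v, n), t)
  have hds : dec s = ((c + 1, encode p, v, n), t) := by simp [hdec, s]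
  have hos : out s = some (bits α n) := by
    simp only [hout, hds, hprog, encodek, Option.getD_some]
    exact ht₀ t ht
  have hws : w s = ⌊α * 2 ^ n⌋₊ := by
    simp only [hw, hos, Option.getD_some, listVal_bits hα0.le hα1]
  have hNs : N s = n := by simp only [hN, hds]
  have has : act s = true := by
    rw [hact_iff, hds, hos]
    exact ⟨hpc, hn, rfl⟩
  have hq1 : (⌊α * 2 ^ n⌋₊ : ℝ) ≤ q s * 2 ^ n + 1 := by
    refine hs₀.le.trans ?_
    gcongr
    exact hqm hs
  have h1 := jumpSeq_succ_ge (act := act) (n := N) (w := w) has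
    (by rw [hws, hNs]; exact_mod_cast hq1)
  rw [hws, hNs, ← hq] at h1
  have h2 : (⌊α * 2 ^ n⌋₊ + 1 : ℝ) ≤ q (s + 1) * 2 ^ n := by exact_mod_cast h1
  have h3 : (q (s + 1) : ℝ) * 2 ^ n ≤ α * 2 ^ n := by gcongr; exact hqα _
  linarith [Nat.lt_floor_add_one (α * 2 ^ n)]

end Auxiliary

/-- a left-c.e. real β ∈ (0,1) is Martin-Löf random iff for every
left-c.e. real α ∈ (0,1) there is c with K(α↾n | β↾n) ≤ c for all n. -/
theorem stmt_18 (β : ℝ) (h1 : β ∈ Set.Ioo (0:ℝ) 1) (h2 : LeftCE β)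
    (M : CondPFMachine) (hM : OptimalCond M) :
    MLRandom β ↔ ∀ α : ℝ, α ∈ Set.Ioo (0:ℝ) 1 → LeftCE α →
      ∃ c : ℕ, ∀ n : ℕ, Kcond M (bits α n) (bits β n) ≤ (c : ℕ∞) := by
  constructor
  · intro hr α hα hαc
    obtain ⟨N, c, hN⟩ := Kcond_le_of_random hα h1 hαc h2 hr
    obtain ⟨c', hc'⟩ := hM N
    refine ⟨c + c', fun n => (hc' _ _).trans ?_⟩
    push_cast
    gcongr
    exact hN n
  · intro h
    by_contra hr
    obtain ⟨α, hα, hαc, hK⟩ := exists_leftCE_Kcond_unbounded h1 hr M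
    obtain ⟨c, hc⟩ := h α hα hαc
    obtain ⟨n, hn⟩ := hK c
    exact hn (hc n)
end
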